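/- Let n ≥ 3 and let nK be the inverse limit continuum determined by the bonding map φ = nφ described in the context. Then nK is not simple-(n−1)-od-like. -/

import Mathlib

/-! ## Simple-n-ods in the plane, likeness, arcs, triods, indecomposability -/

/-- The simple-`n`-od `T_n ⊆ ℂ`: the union of `n` unit segments emanating from `0`. -/
def simpleOdSet (n : ℕ) : Set ℂ :=
  {z | ∃ t : ℝ, ∃ k : ℕ, t ∈ Set.Icc (0:ℝ) 1 ∧ k < n ∧
    z = (t : ℂ) * Complex.exp (2 * Real.pi * Complex.I * (k : ℂ) / (n : ℂ))}

/-- `X` is `Y`-like: for every `ε > 0` there is a continuous surjection `X → Y`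
all of whose point-inverses have diameter `< ε`. -/
def IsLike (X Y : Type*) [MetricSpace X] [MetricSpace Y] : Prop :=
  ∀ ε : ℝ, 0 < ε → ∃ g : X → Y, Continuous g ∧ Function.Surjective g ∧
    ∀ y : Y, Metric.diam (g ⁻¹' {y}) < ε

/-- `A` is an arc: it is homeomorphic to `[0,1]`. -/
def IsArcSet {K : Type*} [TopologicalSpace K] (A : Set K) : Prop :=
  Nonempty (↥A ≃ₜ ↥(Set.Icc (0:ℝ) 1))

/-- Two sets are mutually separated: neither meets the closure of the other. -/
def MutuallySeparated {K : Type*} [TopologicalSpace K] (A B : Set K) : Prop :=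
  A ∩ closure B = ∅ ∧ closure A ∩ B = ∅

/-- The (sub)continuum `C` is a triod: it contains a subcontinuum `M` such that
`C \ M` is the union of three nonempty pairwise mutually separated sets. -/
def IsTriodSet {K : Type*} [TopologicalSpace K] (C : Set K) : Prop :=
  ∃ M A B D : Set K, IsCompact M ∧ IsConnected M ∧ M ⊆ C ∧
    A.Nonempty ∧ B.Nonempty ∧ D.Nonempty ∧ C \ M = A ∪ B ∪ D ∧
    MutuallySeparated A B ∧ MutuallySeparated A D ∧ MutuallySeparated B D

/-- A space is atriodic if it contains no subcontinuum which is a triod. -/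
def AtriodicSpace (K : Type*) [TopologicalSpace K] : Prop :=
  ∀ C : Set K, IsCompact C → IsConnected C → ¬ IsTriodSet C

/-- A space is indecomposable if it is not the union of two proper subcontinua. -/
def IndecomposableSpace (K : Type*) [TopologicalSpace K] : Prop :=
  ¬ ∃ A B : Set K, IsCompact A ∧ IsConnected A ∧ IsCompact B ∧ IsConnected B ∧
    A ≠ Set.univ ∧ B ≠ Set.univ ∧ A ∪ B = Set.univ
/-! ## The simple-`n`-od `S`, the bonding map `φ = nφ`, and the continuum `nK` -/

noncomputable section

/-- Arm-coordinate parametrization of the simple-`n`-od in `ℂ`: the pair `(k, t)`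
is sent to the point at (clamped) parameter `t ∈ [0,1]` on the ray in the
direction `e^{2πik/n}`. -/
def embC (n : ℕ) (p : ℕ × ℝ) : ℂ :=
  ((min 1 (max 0 p.2) : ℝ) : ℂ) * Complex.exp (2 * Real.pi * Complex.I * (p.1 : ℂ) / (n : ℂ))

/-- The underlying simple-`n`-od `S ⊆ ℂ`. -/
def Sset (n : ℕ) : Set ℂ := Set.range (embC n)

/-- The simple-`n`-od `S` as a (compact metric) space. -/
abbrev Sspace (n : ℕ) := ↥(Sset n)

/-- Arm coordinates `(ray index, parameter)` of the vertices `v_0, …, v_{n+2}`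
of the graph `X_0`:  `v_0` is the branch point; for `1 ≤ i ≤ n-2`, `v_i` is the tip
of ray `i - 1`; `v_{n-1}` and `v_{n+1}` are the midpoint and tip of ray `n - 2`;
`v_n` and `v_{n+2}` are the midpoint and tip of ray `n - 1`. -/
def vcoord (n i : ℕ) : ℕ × ℝ :=
  if i = 0 then (0, 0)
  else if i ≤ n - 2 then (i - 1, 1)
  else if i = n - 1 then (n - 2, 1 / 2)
  else if i = n then (n - 1, 1 / 2)
  else if i = n + 1 then (n - 2, 1)
  else (n - 1, 1)

/-- The vertex `v_i` of `X_0` as a point of `S`. -/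
def vpt (n i : ℕ) : Sspace n := ⟨embC n (vcoord n i), Set.mem_range_self _⟩

/-- The branch point `v_0` of `S`. -/
def centerPt (n : ℕ) : Sspace n := vpt n 0

/-- Affine interpolation, in arm coordinates, between two adjacent vertices of
`X_0` (they lie on a common ray; if one of them is the branch point, the ray of
the other one is used). -/
def interpC (w w' : ℕ × ℝ) (s : ℝ) : ℕ × ℝ :=
  (if w.2 = 0 then w'.1 else w.1, (1 - s) * w.2 + s * w'.2)

/-- Arm coordinates of the `φ`-image of the `j`-th vertex of `X_1` (counted from
`v_0` outwards) on the `a`-th arm of `X_1` (`1 ≤ a ≤ n`), following the defining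
table of `φ = nφ`:

* arm `a ≤ n - 3` has vertices `v_0, u_a, u_{(n-3)+a}, …, u_{2(n-1)(n-3)+a}, v_a`;
* arm `n - 2` has vertices `v_0, u_{(2n-1)(n-3)+2(n-1)+1}, v_{n-2}`;
* arm `n - 1` has vertices `v_0, u_{(2n-1)(n-3)+2(n-1)+2}, u_{(2n-1)(n-3)+2(n-1)+3},
  v_{n-1}, v_{n+1}`;
* arm `n` has vertices `v_0, u_{(2n-1)(n-3)+1}, …, u_{(2n-1)(n-3)+2(n-1)}, v_n, v_{n+2}`. -/
def imgCoord (n a j : ℕ) : ℕ × ℝ :=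
  if a = n then
    (if j = 0 then vcoord n 0
     else if j ≤ 2 * n - 2 then
       (if j = 1 then vcoord n (n - 1)
        else if j % 2 = 0 then vcoord n 0
        else if j = 3 then vcoord n (n - 2)
        else vcoord n ((j - 3) / 2))
     else if j = 2 * n - 1 then vcoord n n
     else vcoord n (n + 2))
  else if a = n - 1 then
    (if j = 0 then vcoord n 0
     else if j = 1 then vcoord n (n - 1)
     else if j = 2 then vcoord n 0
     else if j = 3 then vcoord n n
     else vcoord n (n + 2))
  else if a = n - 2 then
    (if j = 0 then vcoord n 0
     else if j = 1 then vcoord n (n - 1)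
     else vcoord n (n + 1))
  else
    (if j = 0 then vcoord n 0
     else if j ≤ 2 * n - 1 then
       (if j = 1 then vcoord n (n - 1)
        else if j = 2 * n - 1 then vcoord n n
        else if (j - 1) % 2 = 1 then vcoord n 0
        else vcoord n ((a + (j - 1) / 2 - 2) % (n - 2) + 1))
     else vcoord n (n + 2))

/-- Locating a parameter `t ∈ [0,1]` on arm `a` of the subdivision `X_1`:
returns the index `j` of the edge of `X_1` containing the point together with the
affine coordinate `s ∈ [0,1]` inside this edge.  The vertices of `X_1` are placed
at: `j/(2n)` (`0 ≤ j ≤ 2n`) on arms `a ≤ n-3`; at `0, 1/2, 1` on arm `n-2`;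
at `0, 1/6, 2/6, 3/6, 1` on arm `n-1` (the vertices `v_{n-1}`, `v_{n+1}` sit at
`1/2` and `1`); and at `j/(4n-2)` (`0 ≤ j ≤ 2n-1`) followed by `1` on arm `n`
(the vertices `v_n`, `v_{n+2}` sit at `1/2` and `1`). -/
def segOf (n a : ℕ) (t : ℝ) : ℕ × ℝ :=
  if a = n then
    (if t ≤ 1 / 2 then
      (min (2 * n - 2) ⌊(4 * (n : ℝ) - 2) * t⌋₊,
        (4 * (n : ℝ) - 2) * t - (min (2 * n - 2) ⌊(4 * (n : ℝ) - 2) * t⌋₊ : ℕ))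
     else (2 * n - 1, 2 * t - 1))
  else if a = n - 1 then
    (if t ≤ 1 / 2 then
      (min 2 ⌊6 * t⌋₊, 6 * t - (min 2 ⌊6 * t⌋₊ : ℕ))
     else (3, 2 * t - 1))
  else if a = n - 2 then
    (min 1 ⌊2 * t⌋₊, 2 * t - (min 1 ⌊2 * t⌋₊ : ℕ))
  else
    (min (2 * n - 1) ⌊2 * (n : ℝ) * t⌋₊,
      2 * (n : ℝ) * t - (min (2 * n - 1) ⌊2 * (n : ℝ) * t⌋₊ : ℕ))

/-- The bonding map `φ` in arm coordinates: a point with arm coordinates `p` lies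
on arm `a = p.1 % n + 1` at parameter `t`; it lies in the `j`-th edge of `X_1`
on this arm with affine coordinate `s`, and is mapped to the corresponding affine
combination of the `φ`-images of the endpoints of this edge. -/
def Gmap (n : ℕ) (p : ℕ × ℝ) : ℕ × ℝ :=
  interpC (imgCoord n (p.1 % n + 1) (segOf n (p.1 % n + 1) (min 1 (max 0 p.2))).1)
    (imgCoord n (p.1 % n + 1) ((segOf n (p.1 % n + 1) (min 1 (max 0 p.2))).1 + 1))
    (segOf n (p.1 % n + 1) (min 1 (max 0 p.2))).2

/-- The piecewise-linear bonding map `f : S → S` induced by `φ`. -/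
def fS (n : ℕ) : Sspace n → Sspace n := fun z =>
  ⟨embC n (Gmap n (Function.invFun (embC n) (z : ℂ))), Set.mem_range_self _⟩

/-- The continuum `nK`: the inverse limit of the sequence `S ←f S ←f S ⋯`,
realized inside the countable product `S^ℕ`. -/
abbrev nK (n : ℕ) := {x : ℕ → Sspace n // ∀ k, fS n (x (k + 1)) = x k}

end

/-- `nK` is metrized as a subspace of the countable product `S^ℕ`. -/
noncomputable instance (n : ℕ) : MetricSpace (∀ _ : ℕ, Sspace n) :=
  PiCountable.metricSpace

/-- A point of an abstract simple `N`-od: an arm and a depth along it. -/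
structure OdPt (N : ℕ) where
  arm : Fin N
  dep : ℝ
  nonneg : 0 ≤ dep

namespace OdPt
variable {N : ℕ}

/-- `z` lies on the segment from the branch point to `p`. -/
def Below (z p : OdPt N) : Prop := z.dep = 0 ∨ (z.arm = p.arm ∧ z.dep ≤ p.dep)

/-- `z` lies on the segment from `p` to `q`. -/
def Seg (p z q : OdPt N) : Prop :=
  (Below z p ∨ Below z q) ∧ ¬ (p.arm = q.arm ∧ z.dep < p.dep ∧ z.dep < q.dep)

theorem Seg.symm {p z q : OdPt N} (h : Seg p z q) : Seg q z p := by
  unfold Seg at *; grind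

theorem seg_left (p q : OdPt N) : Seg p p q := by
  unfold Seg Below; grind

theorem Seg.split {p z r : OdPt N} (h : Seg p z r) (q : OdPt N) : Seg p z q ∨ Seg q z r := by
  have := p.nonneg; have := q.nonneg; have := r.nonneg; have := z.nonneg
  unfold Seg Below at *; grind

theorem Seg.mono {p z q u : OdPt N} (h : Seg p z q) (hu : Seg p u z) : Seg p u q := by
  have := p.nonneg; have := q.nonneg; have := u.nonneg; have := z.nonneg
  unfold Seg Below at *; grind

theorem Below.trans {p z q : OdPt N} (h : Below p z) (hu : Below z q) : Below p q := by
  have := p.nonneg; have := q.nonneg;  have := z.nonneg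
  unfold Below at *; grind

/-- If none of three points lies between the other two, they lie on different arms. -/
theorem median {p q r : OdPt N} (h1 : ¬ Seg p q r) (h2 : ¬ Seg q p r) (h3 : ¬ Seg p r q) :
   p.arm ≠ q.arm ∧ p.arm ≠ r.arm ∧ q.arm ≠ r.arm ∧ 0 < p.dep ∧ 0 < q.dep ∧ 0 < r.dep := by
  have := p.nonneg; have := q.nonneg; have := r.nonneg
  unfold Seg Below at *; grind
end OdPt

/-- Combinatorial description of a vertex of the subdivision not sent to the branch vertex:
a `b`-vertex, the `l`-th vertex of a run of tips of type `t`, or a `c`-vertex. -/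
inductive Info (m : ℕ) where
  | B : Info m
  | A (t : ZMod m) (l : ℕ) : Info m
  | C (t : Option (ZMod m)) : Info m

namespace Info
variable {m : ℕ}

/-- The letter of a vertex: `none` for `b`, `some none` for `c`, `some (some x)` for a tip. -/
def letter : Info m → Option (Option (ZMod m))
  | B => none
  | A t l => some (some (t + l))
  | C _ => some none

/-- The type of the run through a vertex. -/
def typ : Info m → Option (ZMod m)
  | B => none
  | A t _ => some t
  | C t => t

/-- Adjacency of non-central vertices along the words of the bonding map. -/
def RunAdj : Info m → Info m → Prop
  | B, B => True
  | B, A _ l => l = 0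
  | B, C t => t = none
  | A _ l, B => l = 0
  | A t l, A t' l' => t = t' ∧ (l' = l + 1 ∨ l = l' + 1)
  | A t l, C t' => t' = some t ∧ l + 1 = m
  | C t, B => t = none
  | C t', A t l => t' = some t ∧ l + 1 = m
  | C t, C t' => t = t'

theorem RunAdj.symm {x y : Info m} (h : RunAdj x y) : RunAdj y x := by
  cases x <;> cases y <;> simp_all [RunAdj, or_comm]

theorem RunAdj.typ_eq {x y : Info m} (h : RunAdj x y) (hx : x.letter ≠ none)
    (hy : y.letter ≠ none) : x.typ = y.typ := by
  cases x <;> cases y <;> simp_all [RunAdj, typ, letter]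

theorem RunAdj.letter_of_b {x y : Info m} (h : RunAdj x y) (hy : y.letter = none)
    (hx : x.letter ≠ none) {i : ZMod m} (hi : x.typ = some i) : x.letter = some (some i) := by
  cases x <;> cases y <;> simp_all [RunAdj, typ, letter]

theorem RunAdj.typ_of_b {x y : Info m} (h : RunAdj x y) (hy : y.letter = none)
    (hx : x.letter ≠ none) {i : ZMod m} (hi : x.letter = some (some i)) : x.typ = some i := by
  cases x <;> cases y <;> simp_all [RunAdj, typ, letter]

end Info

section Key
open OdPt Info
variable {m N : ℕ} {P : Type*} {info : P → Info m} {h : P → OdPt N}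

/-- Consecutive vertices whose images are separated by a point `o`. -/
def Step (info : P → Info m) (h : P → OdPt N) (y y' : P) : Prop :=
  RunAdj (info y) (info y') ∧ ∃ o : OdPt N,
    (∀ z, Seg (h y) (h z) o → (info z).letter = (info y).letter) ∧
    (∀ z, Seg o (h z) (h y') → (info z).letter = (info y').letter)

theorem Step.symm {y y' : P} (hs : Step info h y y') : Step info h y' y := by
  obtain ⟨h1, o, h2, h3⟩ := hs
  exact ⟨h1.symm, o, fun z hz => h3 z hz.symm, fun z hz => h2 z hz.symm⟩

theorem Step.letter {y y' z : P} (hs : Step info h y y') (hz : Seg (h y) (h z) (h y')) :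
    (info z).letter = (info y).letter ∨ (info z).letter = (info y').letter := by
  obtain ⟨_, o, h2, h3⟩ := hs
  exact (hz.split o).imp (h2 z) (h3 z)

/-- Everything between the branch point and `y` carries the letter of `y`. -/
def Near (info : P → Info m) (h : P → OdPt N) (y : P) : Prop :=
  ∀ z, Below (h z) (h y) → (info z).letter = (info y).letter

/-- `y` is a `c`-vertex joined to `q` through `c`-vertices only. -/
def CVisible (info : P → Info m) (h : P → OdPt N) (q y : P) : Prop :=
  (info y).letter = some none ∧ ∀ z, Seg (h y) (h z) (h q) → (info z).letter = some none

theorem Near.letter_eq {y y' : P} (hy : Near info h y) (hy' : Near info h y')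
    (ha : (h y).arm = (h y').arm ∨ (h y).dep = 0 ∨ (h y').dep = 0) :
    (info y).letter = (info y').letter := by
  rcases le_total (h y).dep (h y').dep with hle | hle
  · apply hy' y
    have := (h y).nonneg; have := (h y').nonneg
    unfold Below; grind
  · symm; apply hy y'
    have := (h y).nonneg; have := (h y').nonneg
    unfold Below; grind

theorem exists_letter_not_near [NeZero m] (hN : N < m + 2) :
    ∃ c : Option (Option (ZMod m)), ∀ y, Near info h y → (info y).letter ≠ c := by
  by_contra hcon
  push Not at hcon
  choose y hy hc using hcon
  have hinj : Function.Injective (fun c => (h (y c)).arm) := by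
    intro c c' hcc
    rw [← hc c, ← hc c']
    exact (hy c).letter_eq (hy c') (Or.inl hcc)
  have := Fintype.card_le_of_injective _ hinj
  simp [ZMod.card] at this
  omega

theorem Step.gate {y y' : P} (hs : Step info h y y') (hy : Near info h y)
    (hy' : ¬ Near info h y') :
    ∃ g, Near info h g ∧ (info g).letter = (info y).letter ∧ Below (h g) (h y') := by
  obtain ⟨_, o, h2, h3⟩ := hs
  unfold Near at hy'
  push Not at hy'
  obtain ⟨g, hg, hgl⟩ := hy'
  have split : ∀ (z p q : OdPt N), Below z p → Seg q z p ∨ Below z q := by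
    intro z p q
    have := p.nonneg; have := q.nonneg; have := z.nonneg
    unfold Seg Below; grind
  have key : Below (h g) (h y) ∨ Seg (h y) (h g) o := by
    rcases split _ _ (h y) hg with h4 | h4
    · rcases h4.split o with h5 | h5
      · exact Or.inr h5
      · exact absurd (h3 g h5) hgl
    · exact Or.inl h4
  refine ⟨g, ?_, key.elim (hy g) (h2 g), hg⟩
  intro z hz
  have e1 : (info g).letter = (info y).letter := key.elim (hy g) (h2 g)
  rw [e1]
  rcases key with h4 | h4
  · exact hy z (hz.trans h4)
  · rcases split _ _ (h y) hz with h5 | h5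
    · exact h2 z (h4.mono h5)
    · exact hy z h5

theorem Step.dep_pos_of_not_near {y y' : P} (hs : Step info h y y') (hy : ¬ Near info h y) :
    0 < (h y).dep := by
  by_contra hneg
  obtain ⟨_, o, h2, h3⟩ := hs
  apply hy
  intro z hz
  apply h2
  have := (h y).nonneg; have := (h z).nonneg
  unfold Seg; unfold Below at *; grind

theorem Step.arm_eq_of_not_near {y y' : P} (hs : Step info h y y') (hy : ¬ Near info h y)
    (hy' : ¬ Near info h y') : (h y).arm = (h y').arm := by
  by_contra hne
  obtain ⟨_, o, h2, h3⟩ := hs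
  by_cases ho : o.arm = (h y).arm
  · apply hy'
    intro z hz
    apply h3
    have := (h y').nonneg; have := (h z).nonneg; have := o.nonneg
    unfold Seg; unfold Below at *; grind
  · apply hy
    intro z hz
    apply h2
    have := (h y).nonneg; have := (h z).nonneg; have := o.nonneg
    unfold Seg; unfold Below at *; grind

theorem typ_eq_of_path {y : ℕ → P} {a b : ℕ} (hab : a ≤ b)
    (hs : ∀ r, a ≤ r → r < b → Step info h (y r) (y (r + 1)))
    (hB : ∀ r, a ≤ r → r ≤ b → (info (y r)).letter ≠ none) :
    (info (y a)).typ = (info (y b)).typ := by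
  induction b, hab using Nat.le_induction with
  | base => rfl
  | succ b hab ih =>
    rw [ih (fun r h1 h2 => hs r h1 (by omega)) (fun r h1 h2 => hB r h1 (by omega))]
    exact (hs b hab (by omega)).1.typ_eq (hB b hab (by omega)) (hB (b + 1) (by omega) le_rfl)

/-- No `b`-vertex lies between the branch point and `y`. -/
def NoB (info : P → Info m) (h : P → OdPt N) (y : P) : Prop :=
  ∀ z, Below (h z) (h y) → (info z).letter ≠ none

theorem Step.noB {y y' : P} (hs : Step info h y y') (hy : NoB info h y)
    (hl : (info y).letter ≠ none) (hl' : (info y').letter ≠ none) : NoB info h y' := by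
  intro z hz
  have split : Seg (h y) (h z) (h y') ∨ Below (h z) (h y) := by
    have := (h y).nonneg; have := (h y').nonneg; have := (h z).nonneg
    unfold Seg; unfold Below at *; grind
  rcases split with h1 | h1
  · rcases hs.letter h1 with h2 | h2 <;> rw [h2] <;> assumption
  · exact hy z h1

theorem noB_of_path {y : ℕ → P} {a b : ℕ} (hab : a ≤ b)
    (hs : ∀ r, a ≤ r → r < b → Step info h (y r) (y (r + 1)))
    (hB : ∀ r, a ≤ r → r ≤ b → (info (y r)).letter ≠ none) :
    NoB info h (y a) ↔ NoB info h (y b) := by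
  induction b, hab using Nat.le_induction with
  | base => rfl
  | succ b hab ih =>
    rw [ih (fun r h1 h2 => hs r h1 (by omega)) (fun r h1 h2 => hB r h1 (by omega))]
    have hb := hB b hab (by omega)
    have hb' := hB (b + 1) (by omega) le_rfl
    exact ⟨fun H => (hs b hab (by omega)).noB H hb hb',
      fun H => (hs b hab (by omega)).symm.noB H hb' hb⟩

theorem arm_eq_of_path {y : ℕ → P} {a b : ℕ} (hab : a ≤ b)
    (hs : ∀ r, a ≤ r → r < b → Step info h (y r) (y (r + 1)))
    (hB : ∀ r, a ≤ r → r ≤ b → ¬ Near info h (y r)) :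
    (h (y a)).arm = (h (y b)).arm := by
  induction b, hab using Nat.le_induction with
  | base => rfl
  | succ b hab ih =>
    rw [ih (fun r h1 h2 => hs r h1 (by omega)) (fun r h1 h2 => hB r h1 (by omega))]
    exact (hs b hab (by omega)).arm_eq_of_not_near (hB b hab (by omega))
      (hB (b + 1) (by omega) le_rfl)

theorem Near.noB {y : P} (hy : Near info h y) (hl : (info y).letter ≠ none) : NoB info h y :=
  fun z hz => by rw [hy z hz]; exact hl

/-- A path leaving the near points and returning to them keeps letter and type. -/
theorem letter_typ_eq_of_gap {y : ℕ → P} {r s : ℕ} (hrs : r + 2 ≤ s)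
    (hs : ∀ k, r ≤ k → k < s → Step info h (y k) (y (k + 1)))
    (hr : Near info h (y r)) (hs' : Near info h (y s))
    (hn : ∀ k, r < k → k < s → ¬ Near info h (y k))
    {i : ZMod m} {l : ℕ} (hA : info (y r) = A i l) :
    (info (y s)).letter = (info (y r)).letter ∧ (info (y s)).typ = (info (y r)).typ := by
  have hdep : ∀ k, r < k → k < s → 0 < (h (y k)).dep := fun k h1 h2 =>
    (hs k (by omega) h2).dep_pos_of_not_near (hn k h1 h2)
  have harm : ∀ k, r < k → k < s → (h (y (r + 1))).arm = (h (y k)).arm := fun k h1 h2 =>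
    arm_eq_of_path (info := info) h1 (fun j h3 h4 => hs j (by omega) (by omega))
      (fun j h3 h4 => hn j (by omega) (by omega))
  obtain ⟨t, rfl⟩ : ∃ t, s = t + 1 := ⟨s - 1, by omega⟩
  have hlet : (info (y (t + 1))).letter = (info (y r)).letter := by
    obtain ⟨g, g1, g2, g3⟩ := (hs r le_rfl (by omega)).gate hr (hn (r + 1) (by omega) (by omega))
    obtain ⟨g', g1', g2', g3'⟩ := (hs t (by omega) (by omega)).symm.gate hs'
      (hn t (by omega) (by omega))
    rw [← g2, ← g2']
    apply g1'.letter_eq g1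
    have := harm t (by omega) (by omega)
    unfold Below at *; grind
  refine ⟨hlet, ?_⟩
  have hlr : (info (y r)).letter ≠ none := by rw [hA]; simp [Info.letter]
  by_cases hBex : ∃ b, r < b ∧ b < t + 1 ∧ (info (y b)).letter = none
  swap
  · refine (typ_eq_of_path (by omega) hs ?_).symm
    intro k h1 h2 h3
    rcases h1.eq_or_lt with rfl | h1
    · exact hlr h3
    rcases h2.eq_or_lt with rfl | h2
    · exact hlr (hlet ▸ h3)
    exact hBex ⟨k, h1, h2, h3⟩
  -- the first and the last `b`-vertex of the gap
  obtain ⟨b1, ⟨hb1, hb1', hb1B⟩, hmin⟩ : ∃ b, (r < b ∧ b < t + 1 ∧ (info (y b)).letter = none) ∧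
      ∀ k, r ≤ k → k < b → (info (y k)).letter ≠ none := by
    classical
    refine ⟨Nat.find hBex, Nat.find_spec hBex, fun k h1 h2 h3 => ?_⟩
    rcases h1.eq_or_lt with rfl | h1
    · exact hlr h3
    · exact Nat.find_min hBex h2 ⟨h1, by have := (Nat.find_spec hBex).2.1; omega, h3⟩
  obtain ⟨b2, ⟨hb2, hb2', hb2B⟩, hmax⟩ : ∃ b, (r < b ∧ b < t + 1 ∧ (info (y b)).letter = none) ∧
      ∀ k, b < k → k ≤ t + 1 → (info (y k)).letter ≠ none := by
    classical
    have hne : ((Finset.range (t + 1)).filter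
        (fun b => r < b ∧ (info (y b)).letter = none)).Nonempty := by
      obtain ⟨b, h1, h2, h3⟩ := hBex
      exact ⟨b, Finset.mem_filter.2 ⟨Finset.mem_range.2 h2, h1, h3⟩⟩
    refine ⟨Finset.max' _ hne, ?_, ?_⟩
    · have := Finset.max'_mem _ hne
      simp only [Finset.mem_filter, Finset.mem_range] at this
      exact ⟨this.2.1, this.1, this.2.2⟩
    · intro k h1 h2 h3
      rcases h2.eq_or_lt with rfl | h2
      · exact hlr (hlet ▸ h3)
      have h4 := Finset.max'_mem _ hne
      simp only [Finset.mem_filter, Finset.mem_range] at h4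
      have h5 := Finset.le_max' ((Finset.range (t + 1)).filter
        (fun b => r < b ∧ (info (y b)).letter = none)) k
        (Finset.mem_filter.2 ⟨Finset.mem_range.2 h2, by omega, h3⟩)
      omega
  obtain ⟨c1, rfl⟩ : ∃ c, b1 = c + 1 := ⟨b1 - 1, by omega⟩
  have t1 : (info (y r)).typ = (info (y c1)).typ := typ_eq_of_path (by omega)
    (fun k h1 h2 => hs k h1 (by omega)) (fun k h1 h2 => hmin k h1 (by omega))
  have t2 : (info (y (b2 + 1))).typ = (info (y (t + 1))).typ := typ_eq_of_path (by omega)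
    (fun k h1 h2 => hs k (by omega) (by omega)) (fun k h1 h2 => hmax k (by omega) (by omega))
  have n1 : NoB info h (y c1) := (noB_of_path (by omega)
    (fun k h1 h2 => hs k h1 (by omega)) (fun k h1 h2 => hmin k h1 (by omega))).1 (hr.noB hlr)
  have n2 : NoB info h (y (b2 + 1)) := (noB_of_path (by omega)
    (fun k h1 h2 => hs k (by omega) (by omega)) (fun k h1 h2 => hmax k (by omega) (by omega))).2
      (hs'.noB (hlet ▸ hlr))
  have s1 := hs c1 (by omega) (by omega)
  have s2 := hs b2 (by omega) (by omega)
  have l1 := hmin c1 (by omega) (by omega)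
  have l2 := hmax (b2 + 1) (by omega) (by omega)
  have hv : (info (y c1)).letter = (info (y (b2 + 1))).letter := by
    have d1 := hdep (c1 + 1) hb1 hb1'
    have d2 := hdep b2 hb2 hb2'
    have a1 := harm (c1 + 1) hb1 hb1'
    have a2 := harm b2 hb2 hb2'
    have e1 := harm c1
    have e2 := harm (b2 + 1)
    have p11 : ¬ Below (h (y (c1 + 1))) (h (y c1)) := fun H => n1 _ H hb1B
    have p12 : ¬ Below (h (y b2)) (h (y c1)) := fun H => n1 _ H hb2B
    have p21 : ¬ Below (h (y (c1 + 1))) (h (y (b2 + 1))) := fun H => n2 _ H hb1B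
    have p22 : ¬ Below (h (y b2)) (h (y (b2 + 1))) := fun H => n2 _ H hb2B
    have q1 : Seg (h (y c1)) (h (y (b2 + 1))) (h (y (c1 + 1))) →
        (info (y c1)).letter = (info (y (b2 + 1))).letter := fun H => by
      rcases s1.letter H with h1 | h1
      · exact h1.symm
      · exact absurd (h1.trans hb1B) l2
    have q2 : Seg (h (y b2)) (h (y c1)) (h (y (b2 + 1))) →
        (info (y c1)).letter = (info (y (b2 + 1))).letter := fun H => by
      rcases s2.letter H with h1 | h1
      · exact absurd (h1.trans hb2B) l1
      · exact h1
    have f1 : r = c1 ∨ r < c1 := by omega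
    have f2 : b2 = t ∨ b2 + 1 < t + 1 := by omega
    have := (h (y c1)).nonneg
    have := (h (y (b2 + 1))).nonneg
    rcases f1 with rfl | f1 <;> rcases f2 with rfl | f2
    · exact hlet.symm
    · unfold Seg at *; unfold Below at *; grind
    · unfold Seg at *; unfold Below at *; grind
    · unfold Seg at *; unfold Below at *; grind
  obtain ⟨i', hi'⟩ : ∃ i', (info (y c1)).typ = some i' := ⟨i, by rw [← t1, hA]; rfl⟩
  rw [← t2, t1, hi']
  exact s2.1.symm.typ_of_b hb2B l2 (hv ▸ s1.1.letter_of_b hb1B l1 hi')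

theorem near_A_of_path {y : ℕ → P} {L : ℕ} {i : ZMod m} {p : ℕ} (hp : p < m)
    (hwf : ∀ z t l, info z = A t l → l < m) (hm : ∀ l l' : ℕ, l < m → l' < m →
      (l : ZMod m) = l' → l = l')
    (hs : ∀ r, r < L → Step info h (y r) (y (r + 1)))
    (hC : ∀ r, 0 < r → r < L → Near info h (y r) → (info (y r)).letter ≠ some none)
    (hz : ∀ z, Near info h z → (info z).letter ≠
      match p with
      | 0 => none
      | q + 1 => some (some (i + q)))
    (h1 : Near info h (y 1)) (h1A : info (y 1) = A i (m - 1)) (r : ℕ) (hr : 0 < r) (hrL : r < L)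
    (hrN : Near info h (y r)) : ∃ l, info (y r) = A i l ∧ p ≤ l := by
  induction r using Nat.strong_induction_on with
  | _ r ih =>
  rcases Nat.lt_or_ge 1 r with hr1 | hr1
  swap
  · obtain rfl : r = 1 := by omega
    exact ⟨m - 1, h1A, by omega⟩
  obtain ⟨k, ⟨hk0, hkr, hkN⟩, hmax⟩ : ∃ k, (0 < k ∧ k < r ∧ Near info h (y k)) ∧
      ∀ j, k < j → j < r → ¬ Near info h (y j) := by
    classical
    have hne : ((Finset.range r).filter (fun k => 0 < k ∧ Near info h (y k))).Nonempty :=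
      ⟨1, Finset.mem_filter.2 ⟨Finset.mem_range.2 hr1, by omega, h1⟩⟩
    have h4 := Finset.max'_mem _ hne
    refine ⟨Finset.max' _ hne, ?_, ?_⟩
    · simp only [Finset.mem_filter, Finset.mem_range] at h4
      exact ⟨h4.2.1, h4.1, h4.2.2⟩
    · intro j h5 h6 h7
      have h8 := Finset.le_max' ((Finset.range r).filter (fun k => 0 < k ∧ Near info h (y k))) j
        (Finset.mem_filter.2 ⟨Finset.mem_range.2 h6, by omega, h7⟩)
      omega
  obtain ⟨l, hl, hpl⟩ := ih k hkr hk0 (by omega) hkN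
  rcases Nat.lt_or_ge (k + 1) r with hgap | hgap
  · obtain ⟨e1, e2⟩ := letter_typ_eq_of_gap hgap (fun j h3 h4 => hs j (by omega)) hkN hrN hmax hl
    refine ⟨l, ?_, hpl⟩
    have w1 := hwf _ _ _ hl
    rw [hl] at e1 e2
    cases hI : info (y r) with
    | B => rw [hI] at e1; simp [Info.letter] at e1
    | C t => rw [hI] at e1; simp [Info.letter] at e1
    | A t l' =>
      have w2 := hwf _ _ _ hI
      rw [hI] at e1 e2
      simp only [Info.letter, Info.typ, Option.some.injEq] at e1 e2
      subst e2
      rw [hm l' l w2 w1 (by simpa using e1)]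
  · obtain rfl : r = k + 1 := by omega
    have hadj := (hs k (by omega)).1
    have hz1 := hz _ hrN
    have hC1 := hC _ hr hrL hrN
    rw [hl] at hadj
    cases hI : info (y (k + 1)) with
    | B =>
      rw [hI] at hadj hz1
      simp only [RunAdj] at hadj
      obtain rfl : p = 0 := by omega
      simp [Info.letter] at hz1
    | C t => rw [hI] at hC1; simp [Info.letter] at hC1
    | A t l' =>
      rw [hI] at hadj hz1
      obtain ⟨rfl, hadj⟩ := hadj
      refine ⟨l', rfl, ?_⟩
      by_contra hlt
      obtain rfl : p = l' + 1 := by omega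
      simp [Info.letter] at hz1

theorem CVisible.of_seg {q x y : P} (hx : CVisible info h q x)
    (hy : (info y).letter = some none)
    (hxy : ∀ z, Seg (h y) (h z) (h x) → (info z).letter = some none) : CVisible info h q y :=
  ⟨hy, fun z hz => (hz.split (h x)).elim (hxy z) (hx.2 z)⟩

theorem typ_eq_of_excursion [NeZero m] (hN : N < m + 2)
    (hwf : ∀ z t l, info z = A t l → l < m) {q : P} {y : ℕ → P} {L : ℕ} (hL : 0 < L)
    (hs : ∀ r, r < L → Step info h (y r) (y (r + 1)))
    (h0 : CVisible info h q (y 0)) (hLv : CVisible info h q (y L))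
    (hno : ∀ r, 0 < r → r < L → ¬ CVisible info h q (y r)) {i : ZMod m}
    (hi : (info (y 0)).typ = some i) : (info (y L)).typ = some i := by
  by_contra hne
  have hm : ∀ l l' : ℕ, l < m → l' < m → (l : ZMod m) = l' → l = l' := by
    intro l l' h1 h2 h3
    rw [ZMod.natCast_eq_natCast_iff'] at h3
    rwa [Nat.mod_eq_of_lt h1, Nat.mod_eq_of_lt h2] at h3
  have hcross : ∀ x, CVisible info h q x → ∀ a b, 0 < a → a ≤ b → b < L →
      ¬ Seg (h (y a)) (h x) (h (y b)) := by
    intro x hx a b ha hab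
    induction b, hab using Nat.le_induction with
    | base =>
      intro hb hseg
      obtain ⟨_, o, h2, h3⟩ := hs a hb
      have h4 : Seg (h (y a)) (h x) o := by
        have := (h (y a)).nonneg; have := (h x).nonneg
        unfold Seg at *; unfold Below at *; grind
      have e := h2 x h4
      rw [hx.1] at e
      exact hno a ha hb (hx.of_seg e.symm fun z hz => (h2 z (h4.mono hz)).trans e.symm)
    | succ b hab ih =>
      intro hb hseg
      rcases hseg.split (h (y b)) with h1 | h1
      · exact ih (by omega) h1
      · obtain ⟨_, o, h2, h3⟩ := hs b (by omega)
        rcases h1.split o with h4 | h4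
        · have e := h2 x h4
          rw [hx.1] at e
          exact hno b (by omega) (by omega) (hx.of_seg e.symm fun z hz =>
            (h2 z (h4.mono hz)).trans e.symm)
        · have e := h3 x h4
          rw [hx.1] at e
          exact hno (b + 1) (by omega) hb (hx.of_seg e.symm fun z hz =>
            (h3 z (h4.symm.mono hz).symm).trans e.symm)
  obtain ⟨t, rfl⟩ : ∃ t, L = t + 1 := ⟨L - 1, by omega⟩
  have s1 := hs 0 hL
  have s2 := hs t (by omega)
  have hC : ∀ I : Info m, I.letter = some none → I = C I.typ := by
    intro I hI; cases I <;> simp_all [Info.letter, Info.typ]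
  -- neighbours of the two ends
  have e0 := hC _ h0.1
  rw [hi] at e0
  have eL := hC _ hLv.1
  have hnoC : ∀ r, 0 < r → r < t + 1 → ∀ x, CVisible info h q x →
      (∀ z, Seg (h (y r)) (h z) (h x) →
        (info z).letter = (info (y r)).letter ∨ (info z).letter = (info x).letter) →
      (info (y r)).letter ≠ some none := by
    intro r h1 h2 x hx hz hr
    refine hno r h1 h2 (hx.of_seg hr fun z hz' => ?_)
    rcases hz z hz' with h3 | h3
    · rw [h3, hr]
    · rw [h3, hx.1]
  have hu1 : 0 < t ∧ info (y 1) = A i (m - 1) := by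
    have hadj := s1.1
    rw [e0] at hadj
    have ht : 0 < t := by
      rcases Nat.eq_zero_or_pos t with rfl | ht
      · simp only [zero_add] at *
        rw [eL] at hadj
        exact absurd hadj.symm hne
      · exact ht
    have hnc := hnoC 1 one_pos (by omega) _ h0 (fun z hz => s1.symm.letter hz)
    refine ⟨ht, ?_⟩
    cases hI : info (y 1) with
    | B => rw [zero_add, hI] at hadj; simp [RunAdj] at hadj
    | C t => rw [hI] at hnc; simp [Info.letter] at hnc
    | A t l =>
      rw [zero_add, hI] at hadj
      obtain ⟨h1, h2⟩ := hadj
      obtain rfl : i = t := by simpa using h1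
      rw [show l = m - 1 by omega]
  obtain ⟨ht, hu1⟩ := hu1
  have hu2 : (info (y t)).letter ≠ some none ∧ (info (y t)).typ ≠ some i ∧
      (info (y t)).letter ≠ (info (y 1)).letter := by
    have hadj := s2.1
    rw [eL] at hadj
    have hnc := hnoC t ht (by omega) _ hLv (fun z hz => s2.letter hz)
    refine ⟨hnc, ?_⟩
    rw [hu1]
    cases hI : info (y t) with
    | B => simp [Info.letter, Info.typ]
    | C t => rw [hI] at hnc; simp [Info.letter] at hnc
    | A t l =>
      rw [hI] at hadj
      obtain ⟨h1, h2⟩ := hadj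
      rw [h1] at hne
      obtain rfl : l = m - 1 := by omega
      simp only [Info.letter, Info.typ]
      refine ⟨hne, fun H => hne ?_⟩
      simp only [Option.some.injEq, add_left_inj] at H
      rw [H]
  obtain ⟨hu2c, hu2t, hu2l⟩ := hu2
  have hu1c : (info (y 1)).letter ≠ some none := by rw [hu1]; simp [Info.letter]
  have hsegC : ∀ z, Seg (h (y 0)) (h z) (h (y (t + 1))) → (info z).letter = some none :=
    fun z hz => (hz.split (h q)).elim (h0.2 z) fun H => hLv.2 z H.symm
  have hseg2 : ∀ z, Seg (h (y 0)) (h z) (h (y t)) →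
      (info z).letter = some none ∨ (info z).letter = (info (y t)).letter := fun z hz =>
    (hz.split (h (y (t + 1)))).elim (fun H => Or.inl (hsegC z H)) fun H =>
      (s2.letter H.symm).symm.imp (fun H => H.trans hLv.1) id
  have hseg1 : ∀ z, Seg (h (y 0)) (h z) (h (y 1)) →
      (info z).letter = some none ∨ (info z).letter = (info (y 1)).letter := fun z hz =>
    (s1.letter hz).imp (fun H => H.trans h0.1) id
  have hvis : ∀ (a : ℕ) (x : P), CVisible info h q x → (info (y a)).letter ≠ some none →
      Step info h x (y a) → ∀ z, Seg (h x) (h z) (h (y a)) → (info z).letter = some none →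
        CVisible info h q z := by
    intro a x hx ha hst z hz hzl
    obtain ⟨_, o, h2, h3⟩ := hst
    rcases hz.split o with h4 | h4
    · refine hx.of_seg hzl fun w hw => ?_
      rw [h2 w (h4.mono hw.symm), hx.1]
    · exact absurd ((h3 z h4).symm.trans hzl) ha
  have hcr : ∀ x, CVisible info h q x → ¬ Seg (h (y 1)) (h x) (h (y t)) := fun x hx =>
    hcross x hx 1 t one_pos (by omega) (by omega)
  obtain ⟨a1, a2, a3, d1, d2, d3⟩ := median (p := h (y 0)) (q := h (y 1)) (r := h (y t))
    (fun H => (hseg2 _ H).elim hu1c hu2l.symm) (hcr _ h0)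
    (fun H => (hseg1 _ H).elim hu2c hu2l)
  have hbelow : ∀ (p q z : OdPt N), p.arm ≠ q.arm → Below z p → Seg q z p := by
    intro p q z; have := p.nonneg; have := q.nonneg; have := z.nonneg
    unfold Seg Below; grind
  have near0 : Near info h (y 0) := by
    intro z hz
    rw [h0.1]
    rcases hseg1 z (hbelow _ _ _ a1 hz).symm with h1 | h1
    · exact h1
    rcases hseg2 z (hbelow _ _ _ a2 hz).symm with h2 | h2
    · exact h2
    exact absurd (h2.symm.trans h1) hu2l
  have near1 : Near info h (y 1) := by
    intro z hz
    have h1 := hbelow _ _ _ a1.symm hz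
    refine (hseg1 z h1).resolve_left fun h2 => ?_
    exact hcr z (hvis 1 _ h0 hu1c s1 z h1 h2) (hbelow _ _ _ a3 hz).symm
  have neart : Near info h (y t) := by
    intro z hz
    have h1 := hbelow _ _ _ a3.symm hz
    refine (hseg2 z (hbelow _ _ _ a2.symm hz)).resolve_left fun h2 => ?_
    refine hcr z ?_ h1
    rcases (hbelow _ _ _ a2.symm hz).split (h (y (t + 1))) with h3 | h3
    · refine h0.of_seg h2 fun w hw => ?_
      exact hsegC w (h3.mono hw.symm)
    · exact hvis t _ hLv hu2c s2.symm z h3 h2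
  have hnear : ∀ z, Near info h z → (info z).letter = some none → CVisible info h q z := by
    intro z hz hzl
    refine h0.of_seg hzl fun w hw => ?_
    rcases hw.1 with h1 | h1
    · rw [hz w h1, hzl]
    · rw [near0 w h1, h0.1]
  obtain ⟨c, hc⟩ := exists_letter_not_near (info := info) (h := h) hN
  obtain ⟨p, hp, hpc⟩ : ∃ p : ℕ, p < m ∧ c = match p with
      | 0 => none
      | q + 1 => some (some (i + q)) := by
    rcases c with _ | _ | x
    · exact ⟨0, NeZero.pos m, rfl⟩
    · exact absurd h0.1 (hc _ near0)
    · refine ⟨(x - i).val + 1, ?_, by simp⟩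
      refine lt_of_le_of_ne (ZMod.val_lt _) fun H => hc _ near1 ?_
      rw [hu1, show m - 1 = (x - i).val by omega]
      simp [Info.letter]
  subst hpc
  obtain ⟨l, hl, -⟩ := near_A_of_path hp hwf hm (fun r hr => hs r (by omega))
    (fun r h1 h2 h3 h4 => hno r h1 h2 (hnear _ h3 h4)) hc near1 hu1 t ht (by omega) neart
  exact hu2t (by rw [hl]; rfl)

theorem typ_eq_of_cVisible [NeZero m] (hN : N < m + 2)
    (hwf : ∀ z t l, info z = A t l → l < m) {q x : P} (hq : (info q).letter = some none)
    (hx : CVisible info h q x) (hpath : Relation.ReflTransGen (Step info h) q x) :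
    (info q).typ = (info x).typ := by
  obtain ⟨L, y, hy0, hyL, hs⟩ : ∃ (L : ℕ) (y : ℕ → P), y 0 = q ∧ y L = x ∧
      ∀ r, r < L → Step info h (y r) (y (r + 1)) := by
    clear hx
    induction hpath with
    | refl => exact ⟨0, fun _ => q, rfl, rfl, fun r hr => by omega⟩
    | @tail b c _ hbc ih =>
      obtain ⟨L, y, h0, hL, hs⟩ := ih
      refine ⟨L + 1, fun r => if r ≤ L then y r else c, by simpa using h0, by simp, ?_⟩
      intro r hr
      rcases Nat.lt_or_ge r L with h1 | h1
      · simpa [h1.le, Nat.succ_le_of_lt h1] using hs r h1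
      · obtain rfl : r = L := by omega
        simpa [hL] using hbc
  have h0 : CVisible info h q (y 0) := by
    rw [hy0]
    refine ⟨hq, fun z hz => ?_⟩
    have h1 : Seg (h x) (h z) (h q) := by
      have := (h q).nonneg; have := (h x).nonneg; have := (h z).nonneg
      unfold Seg at *; unfold Below at *; grind
    exact hx.2 z h1
  have key : ∀ r, r ≤ L → CVisible info h q (y r) → (info (y 0)).typ = (info (y r)).typ := by
    intro r
    induction r using Nat.strong_induction_on with
    | _ r ih =>
    intro hr hv
    rcases Nat.eq_zero_or_pos r with rfl | hr0
    · rfl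
    obtain ⟨k, ⟨hkr, hkN⟩, hmax⟩ : ∃ k, (k < r ∧ CVisible info h q (y k)) ∧
        ∀ j, k < j → j < r → ¬ CVisible info h q (y j) := by
      classical
      have hne : ((Finset.range r).filter (fun k => CVisible info h q (y k))).Nonempty :=
        ⟨0, Finset.mem_filter.2 ⟨Finset.mem_range.2 hr0, h0⟩⟩
      have h4 := Finset.max'_mem _ hne
      refine ⟨Finset.max' _ hne, ?_, ?_⟩
      · simp only [Finset.mem_filter, Finset.mem_range] at h4
        exact h4
      · intro j h5 h6 h7
        have h8 := Finset.le_max' ((Finset.range r).filter (fun k => CVisible info h q (y k))) j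
          (Finset.mem_filter.2 ⟨Finset.mem_range.2 h6, h7⟩)
        omega
    rw [ih k hkr (by omega) hkN]
    obtain ⟨d, rfl⟩ : ∃ d, r = k + d := ⟨r - k, by omega⟩
    cases h1 : (info (y k)).typ with
    | some i =>
      exact (typ_eq_of_excursion hN hwf (y := fun j => y (k + j)) (L := d) (by omega)
        (fun j hj => hs (k + j) (by omega)) hkN hv (fun j h2 h3 => hmax (k + j) (by omega)
          (by omega)) h1).symm
    | none =>
      cases h2 : (info (y (k + d))).typ with
      | none => rfl
      | some i =>
        have := typ_eq_of_excursion hN hwf (y := fun j => y (k + d - j)) (L := d) (q := q) (h := h)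
          (by omega) (fun j hj => ?_) hv (by simpa using hkN)
          (fun j h2 h3 => hmax (k + d - j) (by omega) (by omega)) h2
        · simp only [Nat.add_sub_cancel] at this
          rw [← this, h1]
        · have h3 := (hs (k + d - (j + 1)) (by omega)).symm
          rwa [show k + d - (j + 1) + 1 = k + d - j by omega] at h3
  rw [← hy0, ← hyL]
  exact key L le_rfl (hyL ▸ hx)

end Key

section Words

/-- Number of edges of the `a`-th arm of `X_1`. -/
def armLen (n a : ℕ) : ℕ :=
  if a = n - 1 then 4 else if a = n - 2 then 2 else 2 * n

/-- Type of the run of tips in the word of the arm `a`. -/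
def runType (n a : ℕ) : ℕ := if a = n then n - 3 else a - 1

/-- Index of the vertex of `X_0` to which the `j`-th vertex of the arm `a` of `X_1` is sent. -/
def word (n a j : ℕ) : ℕ :=
  if j = 0 then 0 else if j = 1 then n - 1
  else if a = n - 1 then (if j = 2 then 0 else if j = 3 then n else n + 2)
  else if a = n - 2 then n + 1
  else if j = 2 * n - 1 then n else if 2 * n ≤ j then n + 2
  else if j % 2 = 0 then 0
  else (runType n a + (j - 3) / 2) % (n - 2) + 1

/-- The parent of the vertex `v_e` in the tree `X_0`. -/
def par (n e : ℕ) : ℕ := if e = n + 1 then n - 1 else if e = n + 2 then n else 0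

/-- The arm of `X_0` containing the vertex `v_e`. -/
def armOf (n e : ℕ) : ℕ := if e = n + 1 then n - 1 else if e = n + 2 then n else e

/-- Position of the vertex `v_e` among the vertices of its arm of `X_1`. -/
def hiIdx (n e : ℕ) : ℕ :=
  if e = n - 1 then 3 else if e = n then 2 * n - 1 else armLen n (armOf n e)

/-- Position of the parent of `v_e` among the vertices of the arm of `v_e` in `X_1`. -/
def loIdx (n e : ℕ) : ℕ :=
  if e = n + 1 then 3 else if e = n + 2 then 2 * n - 1 else 0

/-- Index of the image under `φ` of the vertex `v_l`. -/
def phiIdx (n l : ℕ) : ℕ :=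
  if l = 0 then 0 else if l = n - 2 then n + 1 else if l = n - 1 ∨ l = n then n else n + 2

/-- Combinatorial description of the `j`-th vertex of the arm `a` of `X_1`. -/
def vinfo (n a j : ℕ) : Info (n - 2) :=
  if a = n - 1 then (if j = 1 then .B else .C none)
  else if a = n - 2 then .B
  else if j = 1 then .B
  else if j < 2 * n - 1 then .A (runType n a : ℕ) ((j - 3) / 2)
  else .C (some (runType n a : ℕ))

/-- The letter of the vertex `v_l`. -/
def vletter (n l : ℕ) : Option (Option (ZMod (n - 2))) :=
  if l = n - 1 ∨ l = n + 1 then none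
  else if l = n ∨ l = n + 2 then some none
  else some (some ((l - 1 : ℕ) : ZMod (n - 2)))

variable {n a j e l : ℕ}

theorem imgCoord_eq (hn : 3 ≤ n) (ha : 1 ≤ a) (han : a ≤ n) (hj : j ≤ armLen n a) :
    imgCoord n a j = vcoord n (word n a j) := by
  unfold imgCoord word armLen runType at *
  by_cases h1 : a = n
  · subst h1
    have h2 : a ≠ a - 1 := by omega
    have h3 : a ≠ a - 2 := by omega
    simp only [if_true, h2, h3, if_false] at *
    split_ifs <;> first | rfl | omega | skip
    · subst_vars
      simp [Nat.mod_eq_of_lt (show a - 3 < a - 2 by omega)]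
      congr 1; omega
    · congr 1
      have : a - 3 + (j - 3) / 2 = (a - 2) + ((j - 3) / 2 - 1) := by omega
      rw [this, Nat.add_mod_left, Nat.mod_eq_of_lt (by omega)]; omega
  · simp only [h1, if_false] at *
    by_cases h2 : a = n - 1
    · simp only [h2, if_true] at *
      split_ifs <;> rfl
    · simp only [h2, if_false] at *
      by_cases h3 : a = n - 2
      · simp only [h3, if_true] at *
        split_ifs <;> rfl
      · simp only [h3, if_false] at *
        split_ifs <;> first | rfl | omega | skip
        congr 3; omega

theorem word_zero : word n a 0 = 0 := rfl

theorem word_lt (hn : 3 ≤ n) : word n a j ≤ n + 2 := by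
  have := Nat.mod_lt (runType n a + (j - 3) / 2) (show n - 2 > 0 by omega)
  unfold word; split_ifs <;> omega

/-- Values of the words of the three kinds of arms. -/
theorem word_cases (hn : 3 ≤ n) (hj : j ≤ armLen n a) :
    j = 0 ∧ word n a j = 0 ∨ j = 1 ∧ word n a j = n - 1 ∧ vinfo n a j = .B ∨
    a = n - 1 ∧ (j = 2 ∧ word n a j = 0 ∨ j = 3 ∧ word n a j = n ∧ vinfo n a j = .C none ∨
      j = 4 ∧ word n a j = n + 2 ∧ vinfo n a j = .C none) ∨
    a = n - 2 ∧ (j = 2 ∧ word n a j = n + 1 ∧ vinfo n a j = .B) ∨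
    a ≠ n - 1 ∧ a ≠ n - 2 ∧ ((∃ k < n - 2, j = 2 * k + 3 ∧
        word n a j = (runType n a + k) % (n - 2) + 1 ∧ vinfo n a j = .A (runType n a : ℕ) k) ∨
      (∃ k ≤ n - 2, j = 2 * k + 2 ∧ word n a j = 0) ∨
      j = 2 * n - 1 ∧ word n a j = n ∧ vinfo n a j = .C (some (runType n a : ℕ)) ∨
      j = 2 * n ∧ word n a j = n + 2 ∧ vinfo n a j = .C (some (runType n a : ℕ))) := by
  rcases Nat.lt_or_ge j 2 with h | h
  · have h1 : j = 0 ∨ j = 1 := by omega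
    rcases h1 with rfl | rfl
    · simp [word]
    · refine Or.inr (Or.inl ⟨rfl, by simp [word], ?_⟩)
      unfold vinfo; split_ifs <;> first | rfl | contradiction
  refine Or.inr (Or.inr ?_)
  have h0 : j ≠ 0 := by omega
  have h1 : j ≠ 1 := by omega
  unfold armLen at hj
  by_cases ha : a = n - 1
  · rw [if_pos ha] at hj
    refine Or.inl ⟨ha, ?_⟩
    simp only [word, vinfo, ha, if_true, h0, h1, if_false]
    split_ifs <;> grind
  refine Or.inr ?_
  rw [if_neg ha] at hj
  by_cases ha' : a = n - 2
  · rw [if_pos ha'] at hj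
    refine Or.inl ⟨ha', ?_⟩
    have h3 : ¬ n - 2 = n - 1 := by omega
    simp only [word, vinfo, ha', if_true, h0, h1, h3, if_false]
    exact ⟨by omega, trivial, trivial⟩
  refine Or.inr ⟨ha, ha', ?_⟩
  rw [if_neg ha'] at hj
  simp only [word, vinfo, ha, ha', h0, h1, if_false]
  rcases Nat.lt_or_ge j (2 * n - 1) with h2 | h2
  · have h3 : ¬ (j = 2 * n - 1) := by omega
    have h4 : ¬ (2 * n ≤ j) := by omega
    simp only [h2, h3, h4, if_true, if_false]
    rcases Nat.mod_two_eq_zero_or_one j with h5 | h5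
    · exact Or.inr (Or.inl ⟨(j - 2) / 2, by omega, by omega, by simp [h5]⟩)
    · exact Or.inl ⟨(j - 3) / 2, by omega, by omega, by simp [h5], rfl⟩
  · have h4 : ¬ (j < 2 * n - 1) := by omega
    simp only [h4, if_false]
    rcases h2.eq_or_lt with h5 | h5
    · exact Or.inr (Or.inr (Or.inl ⟨h5.symm, by simp [h5], trivial⟩))
    · have h6 : ¬ (j = 2 * n - 1) := by omega
      have h7 : 2 * n ≤ j := by omega
      exact Or.inr (Or.inr (Or.inr ⟨by omega, by simp [h6, h7], trivial⟩))

theorem vletter_b : vletter n (n - 1) = none := by simp [vletter]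

theorem vletter_b' : vletter n (n + 1) = none := by simp [vletter]

theorem vletter_c (hn : 3 ≤ n) : vletter n n = some none := by
  unfold vletter; rw [if_neg (by omega), if_pos (by omega)]

theorem vletter_c' (hn : 3 ≤ n) : vletter n (n + 2) = some none := by
  unfold vletter; rw [if_neg (by omega), if_pos (by omega)]

theorem vletter_a (h : l < n - 2) : vletter n (l + 1) = some (some (l : ZMod (n - 2))) := by
  unfold vletter; rw [if_neg (by omega), if_neg (by omega), Nat.add_sub_cancel]

theorem vinfo_letter (hn : 3 ≤ n) (hj : j ≤ armLen n a)
    (hw : word n a j ≠ 0) : (vinfo n a j).letter = vletter n (word n a j) := by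
  rcases word_cases hn hj with ⟨-, h⟩ | ⟨-, h, h'⟩ | ⟨-, ⟨-, h⟩ | ⟨-, h, h'⟩ | ⟨-, h, h'⟩⟩ |
    ⟨-, -, h, h'⟩ | ⟨-, -, ⟨k, hk, -, h, h'⟩ | ⟨k, hk, -, h⟩ | ⟨-, h, h'⟩ | ⟨-, h, h'⟩⟩
  all_goals first | exact absurd h hw | rw [h, h']
  all_goals simp only [vletter_b, vletter_b', vletter_c hn, vletter_c' hn, Info.letter]
  rw [vletter_a (Nat.mod_lt _ (by omega))]
  simp

theorem vinfo_adj (hn : 3 ≤ n) (hj : j + 1 ≤ armLen n a)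
    (hw : word n a j ≠ 0) (hw' : word n a (j + 1) ≠ 0) :
    (vinfo n a j).RunAdj (vinfo n a (j + 1)) ∧
      vletter n (word n a j) = vletter n (word n a (j + 1)) := by
  rcases word_cases hn (show j ≤ armLen n a by omega) with ⟨i1, h⟩ | ⟨i1, h, h'⟩ |
    ⟨h1, ⟨i1, h⟩ | ⟨i1, h, h'⟩ | ⟨i1, h, h'⟩⟩ |
    ⟨h1, i1, h, h'⟩ | ⟨h1, h2, ⟨k, hk, i1, h, h'⟩ | ⟨k, hk, i1, h⟩ | ⟨i1, h, h'⟩ | ⟨i1, h, h'⟩⟩ <;>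
  first
  | exact absurd h hw
  | rcases word_cases hn hj with ⟨i2, h''⟩ | ⟨i2, h'', h3⟩ | ⟨h4, ⟨i2, h''⟩ | ⟨i2, h'', h3⟩ |
      ⟨i2, h'', h3⟩⟩ |
      ⟨h4, i2, h'', h3⟩ | ⟨h4, h5, ⟨k', hk', i2, h'', h3⟩ | ⟨k', hk', i2, h''⟩ | ⟨i2, h'', h3⟩ |
      ⟨i2, h'', h3⟩⟩ <;>
    first
    | exact absurd h'' hw'
    | (exfalso; omega)
    | (rw [h, h', h'', h3]
       simp only [vletter_b, vletter_b', vletter_c hn, vletter_c' hn, Info.RunAdj, and_self])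

theorem vinfo_adj_two (hn : 3 ≤ n) (hj : j + 2 ≤ armLen n a)
    (hj0 : 0 < j) (hw : word n a (j + 1) = 0) : word n a j ≠ 0 ∧ word n a (j + 2) ≠ 0 ∧
    (vinfo n a j).RunAdj (vinfo n a (j + 2)) := by
  have hpar : (a = n - 1 ∧ j = 1) ∨ (a ≠ n - 1 ∧ a ≠ n - 2 ∧ j % 2 = 1 ∧
      j ≤ 2 * n - 3) := by
    rcases word_cases hn (show j + 1 ≤ armLen n a by omega) with ⟨i1, h⟩ | ⟨i1, h, h'⟩ |
      ⟨h1, ⟨i1, h⟩ | ⟨i1, h, h'⟩ | ⟨i1, h, h'⟩⟩ |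
      ⟨h1, i1, h, h'⟩ | ⟨h1, h2, ⟨k, hk, i1, h, h'⟩ | ⟨k, hk, i1, h⟩ | ⟨i1, h, h'⟩ | ⟨i1, h, h'⟩⟩ <;>
    first
    | (exfalso; omega)
    | exact Or.inl ⟨h1, by omega⟩
    | exact Or.inr ⟨h1, h2, by omega⟩
  rcases word_cases hn (show j ≤ armLen n a by omega) with ⟨i1, h⟩ | ⟨i1, h, h'⟩ |
    ⟨h1, ⟨i1, h⟩ | ⟨i1, h, h'⟩ | ⟨i1, h, h'⟩⟩ |
    ⟨h1, i1, h, h'⟩ | ⟨h1, h2, ⟨k, hk, i1, h, h'⟩ | ⟨k, hk, i1, h⟩ | ⟨i1, h, h'⟩ | ⟨i1, h, h'⟩⟩ <;>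
  first
  | (exfalso; omega)
  | rcases word_cases hn hj with ⟨i2, h''⟩ | ⟨i2, h'', h3⟩ | ⟨h4, ⟨i2, h''⟩ | ⟨i2, h'', h3⟩ |
      ⟨i2, h'', h3⟩⟩ |
      ⟨h4, i2, h'', h3⟩ | ⟨h4, h5, ⟨k', hk', i2, h'', h3⟩ | ⟨k', hk', i2, h''⟩ | ⟨i2, h'', h3⟩ |
      ⟨i2, h'', h3⟩⟩ <;>
    first
    | (exfalso; omega)
    | (rw [h, h', h'', h3]
       refine ⟨by omega, by omega, ?_⟩
       simp only [Info.RunAdj, true_and]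
       try omega)

theorem vinfo_one : vinfo n a 1 = .B := by
  unfold vinfo; split_ifs <;> first | rfl | contradiction

theorem vinfo_wf (hn : 3 ≤ n) {t : ZMod (n - 2)} {k : ℕ} (h : vinfo n a j = .A t k) : k < n - 2 := by
  unfold vinfo at h
  split_ifs at h; cases h
  omega

/-- The index of the edge of `X_0` onto which the `j`-th edge of the arm `a` is sent. -/
theorem exists_edge (hn : 3 ≤ n) (hj : j + 1 ≤ armLen n a) :
    ∃ e, 1 ≤ e ∧ e ≤ n + 2 ∧ ((word n a j = par n e ∧ word n a (j + 1) = e) ∨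
      (word n a (j + 1) = par n e ∧ word n a j = e)) := by
  have hpar : ∀ e, e ≤ n → par n e = 0 := fun e he => by
    unfold par; rw [if_neg (by omega), if_neg (by omega)]
  have hpar1 : par n (n + 1) = n - 1 := by simp [par]
  have hpar2 : par n (n + 2) = n := by simp [par]
  have hmod : ∀ k, (runType n a + k) % (n - 2) < n - 2 := fun k => Nat.mod_lt _ (by omega)
  rcases word_cases hn (show j ≤ armLen n a by omega) with ⟨i1, h⟩ | ⟨i1, h, h'⟩ |
    ⟨h1, ⟨i1, h⟩ | ⟨i1, h, h'⟩ | ⟨i1, h, h'⟩⟩ |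
    ⟨h1, i1, h, h'⟩ | ⟨h1, h2, ⟨k, hk, i1, h, h'⟩ | ⟨k, hk, i1, h⟩ | ⟨i1, h, h'⟩ | ⟨i1, h, h'⟩⟩ <;>
  rcases word_cases hn hj with ⟨i2, h''⟩ | ⟨i2, h'', h3⟩ | ⟨h4, ⟨i2, h''⟩ | ⟨i2, h'', h3⟩ |
      ⟨i2, h'', h3⟩⟩ |
      ⟨h4, i2, h'', h3⟩ | ⟨h4, h5, ⟨k', hk', i2, h'', h3⟩ | ⟨k', hk', i2, h''⟩ | ⟨i2, h'', h3⟩ |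
      ⟨i2, h'', h3⟩⟩ <;>
    first
    | (exfalso; omega)
    | (rw [h, h'']
       first
       | exact ⟨n - 1, by omega, by omega, Or.inl ⟨(hpar _ (by omega)).symm, rfl⟩⟩
       | exact ⟨n - 1, by omega, by omega, Or.inr ⟨(hpar _ (by omega)).symm, rfl⟩⟩
       | exact ⟨n, by omega, by omega, Or.inl ⟨(hpar _ (by omega)).symm, rfl⟩⟩
       | exact ⟨n, by omega, by omega, Or.inr ⟨(hpar _ (by omega)).symm, rfl⟩⟩
       | exact ⟨n + 1, by omega, by omega, Or.inl ⟨hpar1.symm, rfl⟩⟩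
       | exact ⟨n + 2, by omega, by omega, Or.inl ⟨hpar2.symm, rfl⟩⟩
       | exact ⟨_, Nat.succ_pos _, by have := hmod k; omega,
          Or.inr ⟨(hpar _ (by have := hmod k; omega)).symm, rfl⟩⟩
       | exact ⟨_, Nat.succ_pos _, by have := hmod k'; omega,
          Or.inl ⟨(hpar _ (by have := hmod k'; omega)).symm, rfl⟩⟩)

theorem armOf_mem (hn : 3 ≤ n) (he : 1 ≤ e) (hen : e ≤ n + 2) :
    1 ≤ armOf n e ∧ armOf n e ≤ n := by
  unfold armOf; split_ifs <;> omega

theorem lo_lt_hi (hn : 3 ≤ n) : loIdx n e < hiIdx n e := by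
  unfold loIdx hiIdx armLen armOf; split_ifs <;> omega

theorem hi_le (hn : 3 ≤ n) : hiIdx n e ≤ armLen n (armOf n e) := by
  unfold hiIdx armLen armOf; split_ifs <;> omega

theorem word_hi (hn : 3 ≤ n) (he : 1 ≤ e) (hen : e ≤ n + 2) :
    word n (armOf n e) (hiIdx n e) = phiIdx n e := by
  have hc : e = n + 1 ∨ e = n + 2 ∨ e = n ∨ e = n - 1 ∨ e = n - 2 ∨ e ≤ n - 3 := by omega
  have key : ∀ a j w, armOf n e = a → hiIdx n e = j → phiIdx n e = w → word n a j = w →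
      word n (armOf n e) (hiIdx n e) = phiIdx n e := by
    rintro _ _ _ rfl rfl rfl h; exact h
  have htop : ∀ a, a ≠ n - 1 → a ≠ n - 2 →
      word n a (2 * n) = n + 2 ∧ word n a (2 * n - 1) = n := by
    intro a h1 h2
    have : 2 * n ≠ 0 := by omega
    have : 2 * n ≠ 1 := by omega
    have : 2 * n - 1 ≠ 0 := by omega
    have : 2 * n - 1 ≠ 1 := by omega
    have : 2 * n ≠ 2 * n - 1 := by omega
    constructor <;> simp only [word, *] <;> simp
  have h12 : n - 1 ≠ n - 2 := by omega
  rcases hc with h | h | h | h | h | h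
  · have h1 : armOf n e = n - 1 := by unfold armOf; split_ifs; omega
    refine key (n - 1) 4 (n + 2) h1 ?_ ?_ ?_
    · unfold hiIdx; rw [h1]; unfold armLen; split_ifs <;> omega
    · unfold phiIdx; split_ifs <;> omega
    · simp [word]
  · have h1 : armOf n e = n := by unfold armOf; split_ifs <;> omega
    refine key n (2 * n) (n + 2) h1 ?_ ?_ (htop n (by omega) (by omega)).1
    · unfold hiIdx; rw [h1]; unfold armLen; split_ifs <;> omega
    · unfold phiIdx; split_ifs <;> omega
  · refine key n (2 * n - 1) n ?_ ?_ ?_ (htop n (by omega) (by omega)).2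
    · unfold armOf; split_ifs <;> omega
    · unfold hiIdx; split_ifs <;> omega
    · unfold phiIdx; split_ifs <;> omega
  · refine key (n - 1) 3 n ?_ ?_ ?_ (by simp [word])
    · unfold armOf; split_ifs <;> omega
    · unfold hiIdx; split_ifs; omega
    · unfold phiIdx; split_ifs <;> omega
  · have h1 : armOf n e = n - 2 := by unfold armOf; split_ifs <;> omega
    refine key (n - 2) 2 (n + 1) h1 ?_ ?_ ?_
    · unfold hiIdx; rw [h1]; unfold armLen; split_ifs <;> omega
    · unfold phiIdx; split_ifs <;> omega
    · simp [word, h12.symm]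
  · have h1 : armOf n e = e := by unfold armOf; split_ifs <;> omega
    refine key e (2 * n) (n + 2) h1 ?_ ?_ (htop e (by omega) (by omega)).1
    · unfold hiIdx; rw [h1]; unfold armLen; split_ifs <;> omega
    · unfold phiIdx; split_ifs <;> omega

theorem typ_of_c (hn : 3 ≤ n) (hj : j ≤ armLen n a)
    (hw : vletter n (word n a j) = some none) (hw0 : word n a j ≠ 0) :
    (vinfo n a j).typ = if a = n - 1 then none else some (runType n a : ZMod (n - 2)) := by
  rw [← vinfo_letter hn hj hw0] at hw
  unfold vinfo at *
  split_ifs at * <;> first | rfl | contradiction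

end Words

section Concrete
variable {n a j e l k : ℕ}

/-- The point of `S` with arm coordinates `(k, t)`. -/
noncomputable def pt (n k : ℕ) (t : ℝ) : Sspace n := ⟨embC n (k, t), Set.mem_range_self _⟩

/-- Parameter of the `j`-th vertex of the arm `a` of `X_1`. -/
noncomputable def tau (n a j : ℕ) : ℝ :=
  if a = n then (if j ≤ 2 * n - 1 then j / (4 * n - 2) else 1)
  else if a = n - 1 then (if j ≤ 3 then j / 6 else 1)
  else if a = n - 2 then j / 2
  else j / (2 * n)

theorem embC_zero : embC n (k, 0) = 0 := by simp [embC]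

theorem clamp_eq {t : ℝ} (ht : t ∈ Set.Icc (0 : ℝ) 1) : min 1 (max 0 t) = t := by
  rw [max_eq_right ht.1, min_eq_right ht.2]

theorem embC_eq {t : ℝ} (ht : t ∈ Set.Icc (0 : ℝ) 1) :
    embC n (k, t) = t * Complex.exp (2 * Real.pi * Complex.I * k / n) := by
  simp only [embC, clamp_eq ht]

theorem exp_eq_pow : Complex.exp (2 * Real.pi * Complex.I * k / n) =
    Complex.exp (2 * Real.pi * Complex.I / n) ^ k := by
  rw [← Complex.exp_nat_mul]; congr 1; ring

theorem norm_exp_arm : ‖Complex.exp (2 * Real.pi * Complex.I * k / n)‖ = 1 := by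
  have : (2 * Real.pi * Complex.I * k / n : ℂ) = ((2 * Real.pi * k / n : ℝ) : ℂ) * Complex.I := by
    push_cast; ring
  rw [this, Complex.norm_exp_ofReal_mul_I]

theorem embC_mod (hn : n ≠ 0) (t : ℝ) : embC n (k % n, t) = embC n (k, t) := by
  simp only [embC, exp_eq_pow]
  rw [← pow_mod_orderOf _ k, ← (Complex.isPrimitiveRoot_exp n hn).eq_orderOf]

theorem embC_inj {k' : ℕ} {t t' : ℝ} (hn : n ≠ 0) (hk : k < n) (hk' : k' < n)
    (ht : t ∈ Set.Icc (0 : ℝ) 1) (ht' : t' ∈ Set.Icc (0 : ℝ) 1)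
    (h : embC n (k, t) = embC n (k', t')) : t = t' ∧ (t = 0 ∨ k = k') := by
  rw [embC_eq ht, embC_eq ht'] at h
  have h1 : t = t' := by
    have := congrArg norm h
    simpa [norm_exp_arm, abs_of_nonneg ht.1, abs_of_nonneg ht'.1] using this
  refine ⟨h1, ?_⟩
  by_cases h0 : t = 0
  · exact Or.inl h0
  right
  subst h1
  rw [exp_eq_pow, exp_eq_pow] at h
  exact (Complex.isPrimitiveRoot_exp n hn).pow_inj hk hk'
    (mul_left_cancel₀ (by exact_mod_cast h0) h)

theorem pt_inj {k' : ℕ} {t t' : ℝ} (hn : n ≠ 0) (hk : k < n) (hk' : k' < n)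
    (ht : t ∈ Set.Icc (0 : ℝ) 1) (ht' : t' ∈ Set.Icc (0 : ℝ) 1)
    (h : pt n k t = pt n k' t') : t = t' ∧ (t = 0 ∨ k = k') :=
  embC_inj hn hk hk' ht ht' (congrArg Subtype.val h)

theorem exists_pt (hn : n ≠ 0) (x : Sspace n) :
    ∃ k < n, ∃ t ∈ Set.Icc (0 : ℝ) 1, x = pt n k t := by
  obtain ⟨_, ⟨⟨k, t⟩, rfl⟩⟩ := x
  refine ⟨k % n, Nat.mod_lt _ (by omega), min 1 (max 0 t), ⟨by positivity, by simp⟩, ?_⟩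
  apply Subtype.ext
  simp only [pt, embC_mod hn]
  simp [embC]

theorem segOf_zero : segOf n a 0 = (0, 0) := by
  unfold segOf; split_ifs <;> first | (exfalso; norm_num at *; done) | simp

theorem imgCoord_zero : imgCoord n a 0 = (0, 0) := by
  simp [imgCoord, vcoord]

theorem fS_pt (hn : 3 ≤ n) (hk : k < n) {t : ℝ} (ht : t ∈ Set.Icc (0 : ℝ) 1) :
    (fS n (pt n k t) : ℂ) = embC n (interpC (imgCoord n (k + 1) (segOf n (k + 1) t).1)
      (imgCoord n (k + 1) ((segOf n (k + 1) t).1 + 1)) (segOf n (k + 1) t).2) := by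
  have h0 : n ≠ 0 := by omega
  have hinv : embC n (Function.invFun (embC n) (embC n (k, t))) = embC n (k, t) :=
    Function.invFun_eq ⟨_, rfl⟩
  simp only [fS, pt, Gmap]
  generalize Function.invFun (embC n) (embC n (k, t)) = p at *
  obtain ⟨k', t'⟩ := p
  have h2 : embC n (k', t') = embC n (k' % n, min 1 (max 0 t')) := by
    rw [embC_mod h0]; simp [embC]
  rw [h2] at hinv
  have hm : min 1 (max 0 t') ∈ Set.Icc (0 : ℝ) 1 := ⟨by positivity, by simp⟩
  obtain ⟨e1, e2⟩ := embC_inj h0 (Nat.mod_lt _ (by omega)) hk hm ht hinv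
  simp only [e1]
  rcases e2 with e2 | e2
  · rw [e1] at e2
    subst e2
    simp only [segOf_zero, imgCoord_zero]
    simp only [interpC]
    norm_num
    rw [embC_zero, embC_zero]
  · rw [e2]

theorem tau_zero : tau n a 0 = 0 := by
  unfold tau; split_ifs <;> first | omega | simp

theorem tau_last (hn : 3 ≤ n) : tau n a (armLen n a) = 1 := by
  have : (n : ℝ) ≠ 0 := by positivity
  unfold tau armLen; split_ifs <;> first | omega | (push_cast; field_simp)

theorem tau_lt (hn : 3 ≤ n) (hj : j < armLen n a) : tau n a j < tau n a (j + 1) := by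
  have h3 : (3 : ℝ) ≤ n := by exact_mod_cast hn
  have h4 : (0 : ℝ) < 4 * n - 2 := by linarith
  unfold armLen at hj
  unfold tau
  by_cases h1 : a = n
  · have hj' : (j : ℝ) < 2 * n := by split_ifs at hj <;> first | omega | exact_mod_cast hj
    simp only [h1, if_true]
    split_ifs
    · push_cast; gcongr; linarith
    · rw [div_lt_one h4]; linarith
    · omega
    · split_ifs at hj <;> omega
  simp only [h1, if_false]
  by_cases h2 : a = n - 1
  · simp only [h2, if_true] at hj ⊢
    split_ifs
    · push_cast; gcongr; linarith
    · have : (j : ℝ) ≤ 3 := by exact_mod_cast (by omega : j ≤ 3)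
      linarith
    · omega
    · omega
  simp only [h2, if_false]
  split_ifs <;> · push_cast; gcongr; linarith

theorem segOf_tau (hn : 3 ≤ n) (hj : j < armLen n a) {s : ℝ} (hs0 : 0 < s) (hs : s < 1) :
    segOf n a (tau n a j + s * (tau n a (j + 1) - tau n a j)) = (j, s) := by
  have h3 : (3 : ℝ) ≤ n := by exact_mod_cast hn
  have h4 : (0 : ℝ) < 4 * n - 2 := by linarith
  have hfl : ⌊(j : ℝ) + s⌋₊ = j := by
    rw [Nat.floor_eq_iff (by positivity)]; constructor <;> linarith
  unfold armLen at hj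
  unfold tau segOf
  by_cases h1 : a = n
  · have hj' : j < 2 * n := by split_ifs at hj <;> omega
    simp only [h1, if_true]
    rcases Nat.lt_or_ge j (2 * n - 1) with h5 | h5
    · have h6 : j + 1 ≤ 2 * n - 1 := by omega
      have h7 : (j : ℝ) + 1 ≤ 2 * n - 1 := by
        have : ((j + 1 : ℕ) : ℝ) + 1 ≤ (2 * n : ℕ) := by exact_mod_cast (by omega : j + 1 + 1 ≤ 2 * n)
        push_cast at this; linarith
      simp only [h6, h5.le, if_true]
      have e : ((j : ℝ) / (4 * n - 2) + s * (((j + 1 : ℕ) : ℝ) / (4 * n - 2) - j / (4 * n - 2))) =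
          (j + s) / (4 * n - 2) := by push_cast; field_simp; ring
      rw [e, if_pos (by rw [div_le_iff₀ h4]; linarith), mul_div_cancel₀ _ h4.ne', hfl,
        min_eq_right (by omega)]
      simp
    · obtain rfl : j = 2 * n - 1 := by omega
      have h6 : ¬ (2 * n - 1 + 1 ≤ 2 * n - 1) := by omega
      simp only [h6, le_refl, if_true, if_false]
      have e : (((2 * n - 1 : ℕ) : ℝ) / (4 * n - 2)) = 1 / 2 := by
        rw [Nat.cast_sub (by omega)]; push_cast
        rw [div_eq_div_iff h4.ne' two_ne_zero]; ring
      rw [e, if_neg (by linarith)]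
      congr 1; ring
  simp only [h1, if_false]
  by_cases h2 : a = n - 1
  · simp only [h2, if_true] at hj ⊢
    rcases Nat.lt_or_ge j 3 with h5 | h5
    · have h6 : j + 1 ≤ 3 := by omega
      have h7 : (j : ℝ) ≤ 2 := by exact_mod_cast (by omega : j ≤ 2)
      simp only [h6, h5.le, if_true]
      have e : ((j : ℝ) / 6 + s * (((j + 1 : ℕ) : ℝ) / 6 - j / 6)) = (j + s) / 6 := by
        push_cast; ring
      rw [e, if_pos (by linarith), mul_div_cancel₀ _ (by norm_num), hfl, min_eq_right (by omega)]
      simp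
    · obtain rfl : j = 3 := by omega
      norm_num
      rw [if_neg (by linarith)]
      congr 1; ring
  simp only [h2, if_false] at hj ⊢
  by_cases h5 : a = n - 2
  · simp only [h5, if_true] at hj ⊢
    have e : ((j : ℝ) / 2 + s * (((j + 1 : ℕ) : ℝ) / 2 - j / 2)) = (j + s) / 2 := by
      push_cast; ring
    rw [e, mul_div_cancel₀ _ (by norm_num), hfl, min_eq_right (by omega)]
    simp
  · simp only [h5, if_false] at hj ⊢
    have e : ((j : ℝ) / (2 * n) + s * (((j + 1 : ℕ) : ℝ) / (2 * n) - j / (2 * n))) =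
        (j + s) / (2 * n) := by
      push_cast; field_simp; ring
    rw [e, mul_div_cancel₀ _ (by positivity), hfl, min_eq_right (by omega)]
    simp

theorem segOf_tau_vertex (hn : 3 ≤ n) (hj : j ≤ armLen n a) :
    j < armLen n a ∧ segOf n a (tau n a j) = (j, 0) ∨
      0 < j ∧ segOf n a (tau n a j) = (j - 1, 1) := by
  have h3 : (3 : ℝ) ≤ n := by exact_mod_cast hn
  have h4 : (0 : ℝ) < 4 * n - 2 := by linarith
  unfold armLen at *
  unfold tau segOf
  by_cases h1 : a = n
  · have hl : (if a = n - 1 then 4 else if a = n - 2 then 2 else 2 * n) = 2 * n := by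
      split_ifs <;> omega
    rw [hl] at hj ⊢
    simp only [h1, if_true]
    rcases Nat.lt_or_ge j (2 * n) with h5 | h5
    · have h6 : j ≤ 2 * n - 1 := by omega
      have h7 : (j : ℝ) + 1 ≤ 2 * n := by exact_mod_cast (by omega : j + 1 ≤ 2 * n)
      simp only [h6, if_true]
      rw [if_pos (by rw [div_le_iff₀ h4]; linarith), mul_div_cancel₀ _ h4.ne', Nat.floor_natCast]
      rcases Nat.lt_or_ge j (2 * n - 1) with h8 | h8
      · left; rw [min_eq_right (by omega)]; simpa using h5
      · right; rw [min_eq_left (by omega)]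
        refine ⟨by omega, ?_⟩
        rw [show 2 * n - 2 = j - 1 by omega, Nat.cast_sub (by omega)]; simp
    · right
      have h6 : ¬ (j ≤ 2 * n - 1) := by omega
      simp only [h6, if_false]
      norm_num
      omega
  simp only [h1, if_false]
  by_cases h2 : a = n - 1
  · simp only [h2, if_true] at hj ⊢
    rcases Nat.lt_or_ge j 4 with h5 | h5
    · have h6 : j ≤ 3 := by omega
      have h7 : (j : ℝ) ≤ 3 := by exact_mod_cast h6
      simp only [h6, if_true]
      rw [if_pos (by linarith), mul_div_cancel₀ _ (by norm_num), Nat.floor_natCast]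
      rcases Nat.lt_or_ge j 3 with h8 | h8
      · left; rw [min_eq_right (by omega)]; simpa using h5
      · right; rw [min_eq_left (by omega)]
        obtain rfl : j = 3 := by omega
        norm_num
    · right
      obtain rfl : j = 4 := by omega
      norm_num
  simp only [h2, if_false] at hj ⊢
  have hcap : ∀ c d : ℕ, c = d + 1 → j ≤ c →
      j < c ∧ ((min d j, (j : ℝ) - (min d j : ℕ)) : ℕ × ℝ) = (j, 0) ∨
      0 < j ∧ ((min d j, (j : ℝ) - (min d j : ℕ)) : ℕ × ℝ) = (j - 1, 1) := by
    rintro c d rfl hc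
    rcases Nat.lt_or_ge d j with h8 | h8
    · right
      obtain rfl : j = d + 1 := by omega
      rw [min_eq_left (by omega)]; simp
    · left; rw [min_eq_right h8]; simpa using by omega
  by_cases h5 : a = n - 2
  · simp only [h5, if_true] at hj ⊢
    rw [mul_div_cancel₀ _ (by norm_num), Nat.floor_natCast]
    exact hcap 2 1 rfl hj
  · simp only [h5, if_false] at hj ⊢
    rw [mul_div_cancel₀ _ (by positivity), Nat.floor_natCast]
    exact hcap (2 * n) (2 * n - 1) (by omega) hj

theorem tau_mem (hn : 3 ≤ n) (hj : j ≤ armLen n a) : tau n a j ∈ Set.Icc (0 : ℝ) 1 := by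
  constructor
  · clear hj
    have : (2 : ℝ) ≤ 4 * n := by exact_mod_cast (by omega : 2 ≤ 4 * n)
    unfold tau; split_ifs <;> positivity
  · induction hj using Nat.decreasingInduction with
    | self => rw [tau_last hn]
    | of_succ k hk ih => exact (tau_lt hn hk).le.trans ih

/-- Coordinates of a point of the edge of `X_0` with upper vertex `v_e`. -/
noncomputable def edgePt (n e : ℕ) (s : ℝ) : Sspace n :=
  pt n (armOf n e - 1) (tau n (armOf n e) (loIdx n e) +
    s * (tau n (armOf n e) (hiIdx n e) - tau n (armOf n e) (loIdx n e)))

end Concrete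

section Concrete
variable {n a j e l k : ℕ}

/-- The `j`-th vertex of the arm `a` of `X_1`, as a point of `S`. -/
noncomputable def subdivPt (n a j : ℕ) : Sspace n := pt n (a - 1) (tau n a j)

theorem vcoord_zero : vcoord n 0 = (0, 0) := rfl

theorem tau_hi (hn : 3 ≤ n) (he : 1 ≤ e) (hen : e ≤ n + 2) :
    vcoord n e = (armOf n e - 1, tau n (armOf n e) (hiIdx n e)) := by
  have h3 : (3 : ℝ) ≤ n := by exact_mod_cast hn
  have h4 : (0 : ℝ) < 4 * n - 2 := by linarith
  have hc : ((2 * n - 1 : ℕ) : ℝ) = 2 * n - 1 := by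
    rw [Nat.cast_sub (by omega)]; push_cast; ring
  rcases (by omega : e ≤ n - 2 ∨ e = n - 1 ∨ e = n ∨ e = n + 1 ∨ e = n + 2) with h | h | h | h | h
  · have h1 : hiIdx n e = armLen n (armOf n e) := by
      unfold hiIdx; rw [if_neg (by omega), if_neg (by omega)]
    rw [h1, tau_last hn]
    unfold vcoord armOf
    rw [if_neg (by omega), if_pos h, if_neg (by omega), if_neg (by omega)]
  · have h1 : armOf n e = n - 1 := by unfold armOf; grind
    have h2 : hiIdx n e = 3 := by unfold hiIdx; grind
    have h5 : ¬ (n - 1 = n) := by omega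
    rw [h1, h2]
    unfold vcoord tau
    simp only [h5, if_false, if_true, le_refl]
    rw [if_neg (by omega), if_neg (by omega), if_pos (by omega)]
    norm_num; omega
  · have h1 : armOf n e = n := by unfold armOf; grind
    have h2 : hiIdx n e = 2 * n - 1 := by unfold hiIdx; grind
    rw [h1, h2]
    unfold vcoord tau
    simp only [if_true, le_refl]
    rw [if_neg (by omega), if_neg (by omega), if_neg (by omega), if_pos (by omega), hc]
    congr 1; rw [div_eq_div_iff two_ne_zero h4.ne']; ring
  · have h1 : armOf n e = n - 1 := by unfold armOf; grind
    have h2 : hiIdx n e = armLen n (armOf n e) := by unfold hiIdx; grind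
    rw [h2, tau_last hn, h1]
    unfold vcoord
    rw [if_neg (by omega), if_neg (by omega), if_neg (by omega), if_neg (by omega), if_pos h]
    congr 1
  · have h1 : armOf n e = n := by unfold armOf; grind
    have h2 : hiIdx n e = armLen n (armOf n e) := by unfold hiIdx; grind
    rw [h2, tau_last hn, h1]
    unfold vcoord
    rw [if_neg (by omega), if_neg (by omega), if_neg (by omega), if_neg (by omega),
      if_neg (by omega)]

theorem tau_lo (hn : 3 ≤ n) (hen : e ≤ n + 2) :
    (vcoord n (par n e)).2 = tau n (armOf n e) (loIdx n e) ∧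
      (par n e = 0 ∨ (vcoord n (par n e)).1 = armOf n e - 1) := by
  rcases (by omega : e ≤ n ∨ e = n + 1 ∨ e = n + 2) with h | h | h
  · have h1 : par n e = 0 := by unfold par; grind
    have h2 : loIdx n e = 0 := by unfold loIdx; grind
    rw [h1, h2, tau_zero, vcoord_zero]; simp
  · have h1 : par n e = n - 1 := by unfold par; grind
    have h2 : loIdx n e = hiIdx n (n - 1) := by unfold loIdx hiIdx; grind
    have h3 : armOf n e = armOf n (n - 1) := by unfold armOf; grind
    rw [h1, h2, h3, tau_hi hn (by omega) (by omega)]; simp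
  · have h1 : par n e = n := by unfold par; grind
    have h2 : loIdx n e = hiIdx n n := by unfold loIdx hiIdx; grind
    have h3 : armOf n e = armOf n n := by unfold armOf; grind
    rw [h1, h2, h3, tau_hi hn (by omega) (by omega)]; simp

theorem vpt_eq (hn : 3 ≤ n) (he : 1 ≤ e) (hen : e ≤ n + 2) :
    vpt n e = subdivPt n (armOf n e) (hiIdx n e) := by
  simp only [vpt, subdivPt, pt, tau_hi hn he hen]

theorem pt_zero (k : ℕ) : pt n k 0 = vpt n 0 := by
  apply Subtype.ext; simp only [pt, vpt, vcoord_zero, embC_zero]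

theorem vpt_par (hn : 3 ≤ n) (hen : e ≤ n + 2) :
    vpt n (par n e) = subdivPt n (armOf n e) (loIdx n e) := by
  obtain ⟨h1, h2⟩ := tau_lo hn hen
  unfold subdivPt
  rw [← h1]
  rcases h2 with h2 | h2
  · rw [h2, vcoord_zero, pt_zero]
  · rw [← h2]; rfl

theorem edgePt_one (hn : 3 ≤ n) (he : 1 ≤ e) (hen : e ≤ n + 2) : edgePt n e 1 = vpt n e := by
  rw [vpt_eq hn he hen]; simp [edgePt, subdivPt]

theorem edgePt_zero (hn : 3 ≤ n) (hen : e ≤ n + 2) :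
    edgePt n e 0 = vpt n (par n e) := by
  rw [vpt_par hn hen]; simp [edgePt, subdivPt]

theorem interpC_zero (w w' : ℕ × ℝ) : embC n (interpC w w' 0) = embC n w := by
  obtain ⟨c, t⟩ := w
  unfold interpC
  split_ifs with h
  · obtain rfl : t = 0 := h
    simp [embC_zero]
  · simp

theorem tau_lt_of_lt (hn : 3 ≤ n) {j j' : ℕ} (h : j < j') (hj' : j' ≤ armLen n a) :
    tau n a j < tau n a j' := by
  induction j', h using Nat.le_induction with
  | base => exact tau_lt hn hj'
  | succ m hm ih => exact (ih (by omega)).trans (tau_lt hn hj')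

theorem subdivPt_inj (hn : 3 ≤ n) {a' j' : ℕ} (ha : 1 ≤ a) (han : a ≤ n) (ha' : 1 ≤ a')
    (han' : a' ≤ n) (hj : j ≤ armLen n a) (hj' : j' ≤ armLen n a') (h0 : j ≠ 0)
    (h : subdivPt n a j = subdivPt n a' j') : a = a' ∧ j = j' := by
  obtain ⟨h1, h2⟩ := pt_inj (by omega) (by omega) (by omega) (tau_mem hn hj) (tau_mem hn hj') h
  have h3 := tau_lt_of_lt hn (Nat.pos_of_ne_zero h0) hj
  rw [tau_zero] at h3
  have h4 : a = a' := by rcases h2 with h2 | h2 <;> [linarith; omega]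
  subst h4
  refine ⟨rfl, ?_⟩
  rcases lt_trichotomy j j' with h5 | h5 | h5
  · have := tau_lt_of_lt hn h5 hj'; linarith
  · exact h5
  · have := tau_lt_of_lt hn h5 hj; linarith

theorem subdivPt_zero : subdivPt n a 0 = vpt n 0 := by
  rw [subdivPt, tau_zero, pt_zero]

theorem subdivPt_ne_zero (hn : 3 ≤ n) (ha : 1 ≤ a) (han : a ≤ n) (hj : j ≤ armLen n a)
    (h0 : j ≠ 0) : subdivPt n a j ≠ vpt n 0 := by
  intro h
  rw [← subdivPt_zero (a := 1)] at h
  exact h0 (subdivPt_inj hn ha han le_rfl (by omega) hj (by omega) h0 h).2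

/-- The parent relation on vertices of `X_0`, in either order. -/
def IsEdge (n e w w' : ℕ) : Prop := w = par n e ∧ w' = e ∨ w' = par n e ∧ w = e

theorem vcoord_edge (hn : 3 ≤ n) {w w' : ℕ} (he : 1 ≤ e) (hen : e ≤ n + 2)
    (h : IsEdge n e w w') :
    (vcoord n w).2 = 0 ∨ (vcoord n w').2 = 0 ∨ (vcoord n w).1 = (vcoord n w').1 := by
  have h1 := tau_hi hn he hen
  obtain ⟨-, h2⟩ := tau_lo hn hen
  rcases h with ⟨rfl, rfl⟩ | ⟨rfl, rfl⟩ <;> rcases h2 with h2 | h2 <;> simp [h1, h2, vcoord_zero]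

theorem interpC_one {w w' : ℕ × ℝ} (h : w.2 = 0 ∨ w'.2 = 0 ∨ w.1 = w'.1) :
    embC n (interpC w w' 1) = embC n w' := by
  obtain ⟨c, t⟩ := w
  obtain ⟨c', t'⟩ := w'
  unfold interpC
  simp only at h ⊢
  split_ifs with h0
  · simp
  · rcases h with h | h | h
    · contradiction
    · simp [h, embC_zero]
    · simp [h]

theorem edge_of_word (hn : 3 ≤ n) (hj : j < armLen n a) :
    ∃ e, 1 ≤ e ∧ e ≤ n + 2 ∧ IsEdge n e (word n a j) (word n a (j + 1)) :=
  exists_edge hn hj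

theorem fS_subdivPt (hn : 3 ≤ n) (ha : 1 ≤ a) (han : a ≤ n) (hj : j ≤ armLen n a) :
    fS n (subdivPt n a j) = vpt n (word n a j) := by
  apply Subtype.ext
  have ha' : a - 1 + 1 = a := by omega
  rw [subdivPt, fS_pt hn (by omega) (tau_mem hn hj), ha']
  rcases segOf_tau_vertex hn hj with ⟨h1, h2⟩ | ⟨h1, h2⟩
  · rw [h2, interpC_zero, imgCoord_eq hn ha han hj, vpt]
  · rw [h2]
    obtain ⟨i, rfl⟩ : ∃ i, j = i + 1 := ⟨j - 1, by omega⟩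
    obtain ⟨e, he, hen, h⟩ := edge_of_word hn (j := i) (a := a) (by omega)
    simp only [Nat.add_sub_cancel]
    rw [imgCoord_eq hn ha han hj, imgCoord_eq hn ha han (by omega),
      interpC_one (vcoord_edge hn he hen h), vpt]

theorem fS_segment (hn : 3 ≤ n) (ha : 1 ≤ a) (han : a ≤ n) (hj : j < armLen n a) {s : ℝ}
    (hs : s ∈ Set.Icc (0 : ℝ) 1) :
    (fS n (pt n (a - 1) (tau n a j + s * (tau n a (j + 1) - tau n a j))) : ℂ) =
      embC n (interpC (vcoord n (word n a j)) (vcoord n (word n a (j + 1))) s) := by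
  rcases hs.1.eq_or_lt with h0 | h0
  · subst h0
    rw [zero_mul, add_zero, interpC_zero]
    exact congrArg Subtype.val (fS_subdivPt hn ha han hj.le)
  rcases hs.2.eq_or_lt with h1 | h1
  · subst h1
    obtain ⟨e, he, hen, h⟩ := edge_of_word hn hj
    rw [one_mul, add_sub_cancel, interpC_one (vcoord_edge hn he hen h)]
    exact congrArg Subtype.val (fS_subdivPt hn ha han hj)
  have ha' : a - 1 + 1 = a := by omega
  have hm := tau_mem hn hj.le
  have hm' := tau_mem hn hj
  have hlt := tau_lt hn hj
  rw [fS_pt hn (by omega), ha', segOf_tau hn hj h0 h1, imgCoord_eq hn ha han hj.le,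
    imgCoord_eq hn ha han hj]
  constructor <;> nlinarith [hm.1, hm'.2]

theorem edgePt_interpC (hn : 3 ≤ n) (he : 1 ≤ e) (hen : e ≤ n + 2) (s : ℝ) :
    (edgePt n e s : ℂ) = embC n (interpC (vcoord n (par n e)) (vcoord n e) s) ∧
    (edgePt n e (1 - s) : ℂ) = embC n (interpC (vcoord n e) (vcoord n (par n e)) s) := by
  have h1 := tau_hi hn he hen
  obtain ⟨h2, h3⟩ := tau_lo hn hen
  have h4 : 0 < tau n (armOf n e) (hiIdx n e) :=
    tau_zero.symm.trans_lt (tau_lt_of_lt hn (by have := lo_lt_hi (e := e) hn; omega) (hi_le hn))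
  unfold interpC edgePt pt
  constructor
  · refine congrArg (embC n) (Prod.ext ?_ (by simp only [h2, h1]; ring))
    simp only [h1]
    split_ifs with h
    · rfl
    · rcases h3 with h3 | h3
      · rw [h3, vcoord_zero] at h; exact absurd rfl h
      · exact h3.symm
  · refine congrArg (embC n) (Prod.ext ?_ (by simp only [h2, h1]; ring))
    simp only [h1, if_neg h4.ne']

/-- The bonding map carries each edge of `X_1` affinely onto an edge of `X_0`. -/
theorem fS_edge (hn : 3 ≤ n) (ha : 1 ≤ a) (han : a ≤ n) (hj : j < armLen n a) :
    ∃ e, 1 ≤ e ∧ e ≤ n + 2 ∧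
      ((word n a j = par n e ∧ word n a (j + 1) = e ∧ ∀ s ∈ Set.Icc (0 : ℝ) 1,
        fS n (pt n (a - 1) (tau n a j + s * (tau n a (j + 1) - tau n a j))) = edgePt n e s) ∨
      (word n a (j + 1) = par n e ∧ word n a j = e ∧ ∀ s ∈ Set.Icc (0 : ℝ) 1,
        fS n (pt n (a - 1) (tau n a j + s * (tau n a (j + 1) - tau n a j))) =
          edgePt n e (1 - s))) := by
  obtain ⟨e, he, hen, h⟩ := edge_of_word hn hj
  refine ⟨e, he, hen, ?_⟩
  rcases h with ⟨h1, h2⟩ | ⟨h1, h2⟩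
  · refine Or.inl ⟨h1, h2, fun s hs => Subtype.ext ?_⟩
    rw [fS_segment hn ha han hj hs, h1, h2, (edgePt_interpC hn he hen s).1]
  · refine Or.inr ⟨h1, h2, fun s hs => Subtype.ext ?_⟩
    rw [fS_segment hn ha han hj hs, h1, h2, (edgePt_interpC hn he hen s).2]

theorem fS_vpt (hn : 3 ≤ n) (hl : l ≤ n + 2) : fS n (vpt n l) = vpt n (phiIdx n l) := by
  rcases Nat.eq_zero_or_pos l with rfl | h
  · rw [← subdivPt_zero (a := 1), fS_subdivPt hn le_rfl (by omega) (by omega)]; rfl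
  · obtain ⟨h1, h2⟩ := armOf_mem hn h hl
    rw [vpt_eq hn h hl, fS_subdivPt hn h1 h2 (hi_le hn), word_hi hn h hl]

end Concrete

section Continuity
variable {n a e k : ℕ}

theorem continuous_pt (k : ℕ) : Continuous (pt n k) := by
  refine Continuous.subtype_mk ?_ _
  unfold embC
  fun_prop

theorem continuous_edgePt (e : ℕ) : Continuous (edgePt n e) := by
  unfold edgePt
  exact (continuous_pt _).comp (by fun_prop)

theorem surjective_pt (hn : n ≠ 0) :
    Function.Surjective (fun p : Fin n × Set.Icc (0 : ℝ) 1 => pt n p.1 p.2) := fun x => by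
  obtain ⟨k, hk, t, ht, rfl⟩ := exists_pt hn x
  exact ⟨(⟨k, hk⟩, ⟨t, ht⟩), rfl⟩

theorem continuous_pt_prod : Continuous (fun p : Fin n × Set.Icc (0 : ℝ) 1 => pt n p.1 p.2) :=
  continuous_prod_of_discrete_left.2 fun k =>
    (continuous_pt (n := n) k).comp continuous_subtype_val

instance : CompactSpace (Sspace n) := by
  rcases Nat.eq_zero_or_pos n with rfl | hn
  · have : Sset 0 = embC 0 '' ({0} ×ˢ Set.Icc 0 1) := by
      ext z; constructor
      · rintro ⟨⟨k, t⟩, rfl⟩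
        exact ⟨(0, min 1 (max 0 t)), ⟨rfl, by positivity, by simp⟩, by simp [embC]⟩
      · rintro ⟨p, -, rfl⟩; exact ⟨p, rfl⟩
    rw [← isCompact_iff_compactSpace, this]
    refine (isCompact_singleton.prod isCompact_Icc).image ?_
    unfold embC; fun_prop
  · exact (surjective_pt hn.ne').compactSpace continuous_pt_prod

theorem continuous_fS (hn : 3 ≤ n) : Continuous (fS n) := by
  rw [(continuous_pt_prod.isClosedMap.isQuotientMap continuous_pt_prod
    (surjective_pt (by omega))).continuous_iff]
  refine continuous_prod_of_discrete_left.2 fun k => ?_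
  suffices h : ∀ j ≤ armLen n (k + 1), ContinuousOn (fun t : ℝ => fS n (pt n k t))
      (Set.Icc 0 (tau n (k + 1) j)) by
    have := h _ le_rfl
    rw [tau_last hn] at this
    exact continuousOn_iff_continuous_domRestrict.1 this
  intro j
  induction j with
  | zero => intro _; rw [tau_zero, Set.Icc_self]; exact continuousOn_singleton _ _
  | succ j ih =>
    intro hj
    have hlt := tau_lt hn hj
    rw [← Set.Icc_union_Icc_eq_Icc (tau_mem hn (Nat.le_of_lt hj)).1 hlt.le]
    refine (ih (Nat.le_of_lt hj)).union_of_isClosed ?_ isClosed_Icc isClosed_Icc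
    obtain ⟨e, -, -, h⟩ := fS_edge hn (Nat.le_add_left 1 k) k.2 hj
    have key : ∀ g : ℝ → Sspace n, Continuous g → (∀ s ∈ Set.Icc (0 : ℝ) 1,
        fS n (pt n k (tau n (k + 1) j + s * (tau n (k + 1) (j + 1) - tau n (k + 1) j))) = g s) →
        ContinuousOn (fun t : ℝ => fS n (pt n k t))
          (Set.Icc (tau n (k + 1) j) (tau n (k + 1) (j + 1))) := by
      intro g hg h
      have hd : 0 < tau n (k + 1) (j + 1) - tau n (k + 1) j := sub_pos.2 hlt
      have hg' : Continuous fun t =>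
          g ((t - tau n (k + 1) j) / (tau n (k + 1) (j + 1) - tau n (k + 1) j)) :=
        hg.comp (by fun_prop)
      refine hg'.continuousOn.congr fun t ht => ?_
      simp only
      rw [← h _ ⟨div_nonneg (sub_nonneg.2 ht.1) hd.le,
        (div_le_one hd).2 (sub_le_sub_right ht.2 _)⟩, div_mul_cancel₀ _ hd.ne', add_sub_cancel]
    rcases h with ⟨-, -, h⟩ | ⟨-, -, h⟩
    · exact key _ (continuous_edgePt e) h
    · exact key _ ((continuous_edgePt e).comp (continuous_const.sub continuous_id)) h

end Continuity

section Arcs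
variable {n a j e l k : ℕ} {γ : ℝ → Sspace n}

/-- `γ` is a path which the `k`-th iterate of the bonding map carries onto the edge of `X_0`
below `v_e`, preserving the parameter. -/
structure IsArc (n k e : ℕ) (γ : ℝ → Sspace n) : Prop where
  one_le : 1 ≤ e
  le : e ≤ n + 2
  cont : ContinuousOn γ (Set.Icc 0 1)
  map : ∀ s ∈ Set.Icc (0 : ℝ) 1, (fS n)^[k] (γ s) = edgePt n e s

/-- `x` and `y` are the endpoints of a path which the `k`-th iterate of the bonding map carries
onto an edge of `X_0` with endpoints `v_w` and `v_{w'}`. -/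
def Link (n k w w' : ℕ) (x y : Sspace n) : Prop :=
  ∃ e γ, IsArc n k e γ ∧ (w = par n e ∧ w' = e ∧ γ 0 = x ∧ γ 1 = y ∨
    w' = par n e ∧ w = e ∧ γ 0 = y ∧ γ 1 = x)

theorem Link.symm {w w' : ℕ} {x y : Sspace n} (h : Link n k w w' x y) : Link n k w' w y x := by
  obtain ⟨e, γ, h, h'⟩ := h; exact ⟨e, γ, h, h'.symm⟩

theorem IsArc.link (h : IsArc n k e γ) : Link n k (par n e) e (γ 0) (γ 1) :=
  ⟨e, γ, h, Or.inl ⟨rfl, rfl, rfl, rfl⟩⟩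

/-- Parameter of the `j`-th vertex of `X_1` on the edge of `X_0` below `v_e`. -/
noncomputable def theta (n e j : ℕ) : ℝ :=
  (tau n (armOf n e) j - tau n (armOf n e) (loIdx n e)) /
    (tau n (armOf n e) (hiIdx n e) - tau n (armOf n e) (loIdx n e))

theorem edge_length_pos (hn : 3 ≤ n) :
    0 < tau n (armOf n e) (hiIdx n e) - tau n (armOf n e) (loIdx n e) :=
  sub_pos.2 (tau_lt_of_lt hn (lo_lt_hi hn) (hi_le hn))

theorem theta_lo : theta n e (loIdx n e) = 0 := by simp [theta]

theorem theta_hi (hn : 3 ≤ n) : theta n e (hiIdx n e) = 1 := div_self (edge_length_pos hn).ne'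

theorem theta_le (hn : 3 ≤ n) {i : ℕ} (h : i ≤ j) (hj : j ≤ hiIdx n e) :
    theta n e i ≤ theta n e j := by
  rcases h.eq_or_lt with rfl | h
  · rfl
  · have := tau_lt_of_lt hn h (hj.trans (hi_le hn))
    have := edge_length_pos (e := e) hn
    unfold theta; gcongr

theorem theta_mem (hn : 3 ≤ n) (h : loIdx n e ≤ j) (hj : j ≤ hiIdx n e) :
    theta n e j ∈ Set.Icc (0 : ℝ) 1 := by
  rw [← theta_lo (n := n) (e := e), ← theta_hi (e := e) hn]
  exact ⟨theta_le hn h hj, theta_le hn hj le_rfl⟩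

theorem edgePt_theta (hn : 3 ≤ n) (e j : ℕ) :
    edgePt n e (theta n e j) = subdivPt n (armOf n e) j := by
  rw [edgePt, theta, div_mul_cancel₀ _ (edge_length_pos hn).ne', add_sub_cancel, subdivPt]

theorem IsArc.map_theta (hn : 3 ≤ n) (h : IsArc n k e γ) (h1 : loIdx n e ≤ j)
    (h2 : j ≤ hiIdx n e) : (fS n)^[k] (γ (theta n e j)) = subdivPt n (armOf n e) j := by
  rw [h.map _ (theta_mem hn h1 h2), edgePt_theta hn]

theorem IsArc.sub (hn : 3 ≤ n) (h : IsArc n k e γ) (h1 : loIdx n e ≤ j) (h2 : j < hiIdx n e) :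
    ∃ e' γ', IsArc n (k + 1) e' γ' ∧
      (∀ t ∈ Set.Icc (theta n e j) (theta n e (j + 1)), ∃ s ∈ Set.Icc (0 : ℝ) 1, γ' s = γ t) ∧
      (word n (armOf n e) j = par n e' ∧ word n (armOf n e) (j + 1) = e' ∧
          γ' 0 = γ (theta n e j) ∧ γ' 1 = γ (theta n e (j + 1)) ∨
        word n (armOf n e) (j + 1) = par n e' ∧ word n (armOf n e) j = e' ∧
          γ' 0 = γ (theta n e (j + 1)) ∧ γ' 1 = γ (theta n e j)) := by
  obtain ⟨ha, han⟩ := armOf_mem hn h.one_le h.le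
  obtain ⟨e', he, hen, H⟩ := fS_edge hn ha han (h2.trans_le (hi_le hn))
  have hL := edge_length_pos (e := e) hn
  have hd : 0 < theta n e (j + 1) - theta n e j := by
    have := tau_lt hn (h2.trans_le (hi_le hn))
    rw [sub_pos]; unfold theta; gcongr
  set p : ℝ → ℝ := fun s => theta n e j + s * (theta n e (j + 1) - theta n e j) with hp
  have hpm : ∀ s ∈ Set.Icc (0 : ℝ) 1, p s ∈ Set.Icc (0 : ℝ) 1 := fun s hs => by
    have a1 := theta_mem hn h1 h2.le
    have a2 := theta_mem (e := e) (j := j + 1) hn (by omega) h2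
    constructor <;> simp only [hp] <;> nlinarith [hs.1, hs.2, a1.1, a2.2]
  have hpmap : ∀ s ∈ Set.Icc (0 : ℝ) 1, (fS n)^[k] (γ (p s)) = pt n (armOf n e - 1)
      (tau n (armOf n e) j + s * (tau n (armOf n e) (j + 1) - tau n (armOf n e) j)) :=
    fun s hs => by
      rw [h.map _ (hpm s hs), edgePt]
      congr 1
      simp only [hp, theta]
      field_simp
      ring
  have hpc : ContinuousOn (fun s => γ (p s)) (Set.Icc 0 1) :=
    h.cont.comp (by fun_prop) hpm
  have hinv : ∀ t ∈ Set.Icc (theta n e j) (theta n e (j + 1)), ∃ s ∈ Set.Icc (0 : ℝ) 1, p s = t :=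
    fun t ht => ⟨(t - theta n e j) / (theta n e (j + 1) - theta n e j),
      ⟨div_nonneg (sub_nonneg.2 ht.1) hd.le, (div_le_one hd).2 (sub_le_sub_right ht.2 _)⟩, by
        simp only [hp]; rw [div_mul_cancel₀ _ hd.ne']; ring⟩
  have hflip : ∀ s ∈ Set.Icc (0 : ℝ) 1, 1 - s ∈ Set.Icc (0 : ℝ) 1 := fun s hs =>
    ⟨by linarith [hs.2], by linarith [hs.1]⟩
  rcases H with ⟨w1, w2, H⟩ | ⟨w1, w2, H⟩
  · refine ⟨e', fun s => γ (p s), ⟨he, hen, hpc, fun s hs => ?_⟩, fun t ht => ?_,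
      Or.inl ⟨w1, w2, by simp [hp], by simp [hp]⟩⟩
    · rw [Function.iterate_succ_apply', hpmap s hs, H s hs]
    · obtain ⟨s, hs, rfl⟩ := hinv t ht; exact ⟨s, hs, rfl⟩
  · refine ⟨e', fun s => γ (p (1 - s)), ⟨he, hen, ?_, fun s hs => ?_⟩, fun t ht => ?_,
      Or.inr ⟨w1, w2, by simp [hp], by simp [hp]⟩⟩
    · exact hpc.comp (by fun_prop : ContinuousOn (fun s : ℝ => 1 - s) _) hflip
    · rw [Function.iterate_succ_apply', hpmap _ (hflip s hs), H _ (hflip s hs), sub_sub_cancel]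
    · obtain ⟨s, hs, rfl⟩ := hinv t ht
      exact ⟨1 - s, hflip s hs, by simp only [sub_sub_cancel]⟩

theorem IsArc.sub_link (hn : 3 ≤ n) (h : IsArc n k e γ) (h1 : loIdx n e ≤ j)
    (h2 : j < hiIdx n e) : Link n (k + 1) (word n (armOf n e) j) (word n (armOf n e) (j + 1))
      (γ (theta n e j)) (γ (theta n e (j + 1))) := by
  obtain ⟨e', γ', h, -, h'⟩ := h.sub hn h1 h2; exact ⟨e', γ', h, h'⟩

/-- `x` is joined to the branch point by a chain of paths of level `k`. -/
def Reach (n k : ℕ) : Sspace n → Prop :=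
  Relation.ReflTransGen (fun x y => ∃ w w', Link n k w w' x y) (vpt n 0)

theorem IsArc.reach_theta (hn : 3 ≤ n) (h : IsArc n k e γ) (hr : Reach n (k + 1) (γ 0))
    (h1 : loIdx n e ≤ j) (h2 : j ≤ hiIdx n e) : Reach n (k + 1) (γ (theta n e j)) := by
  induction j, h1 using Nat.le_induction with
  | base => rwa [theta_lo]
  | succ j hj ih => exact (ih (by omega)).tail ⟨_, _, h.sub_link hn hj h2⟩

theorem IsArc.reach_theta' (hn : 3 ≤ n) (h : IsArc n k e γ) (hr : Reach n (k + 1) (γ 1))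
    (h1 : loIdx n e ≤ j) (h2 : j ≤ hiIdx n e) : Reach n (k + 1) (γ (theta n e j)) := by
  induction h2 using Nat.decreasingInduction with
  | self => rwa [theta_hi hn]
  | of_succ j hj ih => exact (ih (by omega)).tail ⟨_, _, (h.sub_link hn h1 hj).symm⟩

theorem Reach.succ (hn : 3 ≤ n) {x : Sspace n} (h : Reach n k x) : Reach n (k + 1) x := by
  induction h with
  | refl => exact .refl
  | tail _ h ih =>
    obtain ⟨w, w', e, γ, h, ⟨-, -, rfl, rfl⟩ | ⟨-, -, rfl, rfl⟩⟩ := h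
    · have := h.reach_theta hn ih (lo_lt_hi hn).le le_rfl
      rwa [theta_hi hn] at this
    · have := h.reach_theta' hn ih le_rfl (lo_lt_hi hn).le
      rwa [theta_lo] at this

theorem isArc_edgePt (he : 1 ≤ e) (hen : e ≤ n + 2) : IsArc n 0 e (edgePt n e) :=
  ⟨he, hen, (continuous_edgePt e).continuousOn, fun _ _ => rfl⟩

theorem reach_zero (hn : 3 ≤ n) (he : 1 ≤ e) (hen : e ≤ n) : Reach n 0 (vpt n e) := by
  have h := isArc_edgePt (n := n) he (by omega)
  have h2 := h.link
  rw [edgePt_one hn he (by omega), edgePt_zero hn (by omega)] at h2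
  have : par n e = 0 := by unfold par; grind
  rw [this] at h2
  exact .tail .refl ⟨_, _, h2⟩

theorem exists_edgePt (hn : 3 ≤ n) (x : Sspace n) :
    ∃ e, 1 ≤ e ∧ e ≤ n + 2 ∧ ∃ s ∈ Set.Icc (0 : ℝ) 1, edgePt n e s = x := by
  obtain ⟨k, hk, t, ht, rfl⟩ := exists_pt (by omega) x
  have key : ∀ e, armOf n e = k + 1 → tau n (armOf n e) (loIdx n e) ≤ t →
      t ≤ tau n (armOf n e) (hiIdx n e) → ∃ s ∈ Set.Icc (0 : ℝ) 1, edgePt n e s = pt n k t := by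
    intro e he h1 h2
    have hd := edge_length_pos (e := e) hn
    refine ⟨(t - tau n (armOf n e) (loIdx n e)) / _, ⟨div_nonneg (sub_nonneg.2 h1) hd.le,
      (div_le_one hd).2 (sub_le_sub_right h2 _)⟩, ?_⟩
    rw [edgePt, div_mul_cancel₀ _ hd.ne', add_sub_cancel, he, Nat.add_sub_cancel]
  have hlo : ∀ e ≤ n, loIdx n e = 0 := fun e he => by unfold loIdx; grind
  rcases le_or_gt t (tau n (armOf n (k + 1)) (hiIdx n (k + 1))) with h | h
  · refine ⟨k + 1, by omega, by omega, key _ (by unfold armOf; grind) ?_ h⟩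
    rw [hlo _ (by omega), tau_zero]; exact ht.1
  · have hhi : ∀ e, hiIdx n e = armLen n (armOf n e) → tau n (armOf n e) (hiIdx n e) = 1 :=
      fun e he => by rw [he, tau_last hn]
    rcases (by omega : k < n - 2 ∨ k = n - 2 ∨ k = n - 1) with h1 | h1 | h1
    · rw [hhi _ (by unfold hiIdx; grind)] at h
      exact absurd ht.2 h.not_ge
    · have e1 : armOf n (n + 1) = armOf n (k + 1) := by unfold armOf; grind
      have e2 : loIdx n (n + 1) = hiIdx n (k + 1) := by unfold loIdx hiIdx; grind
      refine ⟨n + 1, by omega, by omega, key _ (by unfold armOf; grind) ?_ ?_⟩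
      · rw [e1, e2]; exact h.le
      · rw [hhi _ (by unfold hiIdx; grind)]; exact ht.2
    · have e1 : armOf n (n + 2) = armOf n (k + 1) := by unfold armOf; grind
      have e2 : loIdx n (n + 2) = hiIdx n (k + 1) := by unfold loIdx hiIdx; grind
      refine ⟨n + 2, by omega, by omega, key _ (by unfold armOf; grind) ?_ ?_⟩
      · rw [e1, e2]; exact h.le
      · rw [hhi _ (by unfold hiIdx; grind)]; exact ht.2

theorem exists_theta (hn : 3 ≤ n) {t : ℝ} (ht : t ∈ Set.Icc (0 : ℝ) 1) :
    ∃ j, loIdx n e ≤ j ∧ j < hiIdx n e ∧ t ∈ Set.Icc (theta n e j) (theta n e (j + 1)) := by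
  by_contra! H
  have : ∀ j, loIdx n e ≤ j → j ≤ hiIdx n e → theta n e j ≤ t := by
    intro j hj
    induction j, hj using Nat.le_induction with
    | base => intro _; rw [theta_lo]; exact ht.1
    | succ j hj ih =>
      intro h
      have h1 := ih (by omega)
      have h2 := H j hj h
      by_contra! h3
      exact h2 ⟨h1, h3.le⟩
  have hlt := lo_lt_hi (e := e) hn
  have h1 := this (hiIdx n e - 1) (by omega) (by omega)
  have h2 := H (hiIdx n e - 1) (by omega) (by omega)
  refine h2 ⟨h1, ?_⟩
  rw [Nat.sub_add_cancel (by omega), theta_hi hn]; exact ht.2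

/-- Every point lies on a path of level `k` joined to the branch point by paths of level `k`. -/
theorem exists_isArc (hn : 3 ≤ n) (k : ℕ) (x : Sspace n) :
    ∃ e γ, IsArc n k e γ ∧ Reach n k (γ 0) ∧ ∃ s ∈ Set.Icc (0 : ℝ) 1, γ s = x := by
  induction k with
  | zero =>
    obtain ⟨e, he, hen, s, hs, rfl⟩ := exists_edgePt hn x
    refine ⟨e, _, isArc_edgePt he hen, ?_, s, hs, rfl⟩
    rw [edgePt_zero hn hen]
    rcases (by omega : e ≤ n ∨ e = n + 1 ∨ e = n + 2) with h | h | h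
    · rw [show par n e = 0 by unfold par; grind]; exact .refl
    · rw [show par n e = n - 1 by unfold par; grind]
      exact reach_zero hn (by omega) (by omega)
    · rw [show par n e = n by unfold par; grind]
      exact reach_zero hn (by omega) (by omega)
  | succ k ih =>
    obtain ⟨e, γ, h, hr, s, hs, rfl⟩ := ih
    obtain ⟨j, h1, h2, ht⟩ := exists_theta (e := e) hn hs
    obtain ⟨e', γ', h', hsub, H⟩ := h.sub hn h1 h2
    obtain ⟨s', hs', hs''⟩ := hsub s ht
    refine ⟨e', γ', h', ?_, s', hs', hs''⟩
    rcases H with ⟨-, -, H, -⟩ | ⟨-, -, H, -⟩ <;> rw [H]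
    · exact h.reach_theta hn (hr.succ hn) h1 h2.le
    · exact h.reach_theta hn (hr.succ hn) (by omega) h2

end Arcs

section Connectivity
open OdPt Relation
variable {n N k e l : ℕ} {γ : ℝ → Sspace n} {h : Sspace n → OdPt N}

/-- Along each path of level `k`, only the ends of its image edge are visited in the `N`-od. -/
def Tight (n k : ℕ) (h : Sspace n → OdPt N) : Prop :=
  ∀ w w' x y, Link n k w w' x y → ∀ z, ∀ l ≤ n + 2, (fS n)^[k] z = vpt n l →
    Seg (h x) (h z) (h y) → l = w ∨ l = w'

/-- A point of `S` which the `k`-th iterate of the bonding map sends to a vertex of `X_1` that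
is not sent to the branch point. -/
@[ext] structure Mark (n k : ℕ) where
  pos : Sspace n
  arm : ℕ
  idx : ℕ
  one_le : 1 ≤ arm
  le : arm ≤ n
  idx_le : idx ≤ armLen n arm
  map_pos : (fS n)^[k] pos = subdivPt n arm idx
  word_ne : word n arm idx ≠ 0

namespace Mark

/-- Combinatorial description of a marked point. -/
def info (p : Mark n k) : Info (n - 2) := vinfo n p.arm p.idx

theorem idx_ne (p : Mark n k) : p.idx ≠ 0 := fun h => p.word_ne (by rw [h, word_zero])

theorem letter (hn : 3 ≤ n) (p : Mark n k) :
    p.info.letter = vletter n (word n p.arm p.idx) := vinfo_letter hn p.idx_le p.word_ne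

theorem map_succ (hn : 3 ≤ n) (p : Mark n k) :
    (fS n)^[k + 1] p.pos = vpt n (word n p.arm p.idx) := by
  rw [Function.iterate_succ_apply', p.map_pos, fS_subdivPt hn p.one_le p.le p.idx_le]

theorem eq_of_pos (hn : 3 ≤ n) {p q : Mark n k} (h : p.pos = q.pos) : p = q := by
  obtain ⟨h1, h2⟩ := subdivPt_inj hn p.one_le p.le q.one_le q.le p.idx_le q.idx_le p.idx_ne
    (by rw [← p.map_pos, ← q.map_pos, h])
  exact Mark.ext h h1 h2

end Mark

/-- The step relation between marked points. -/
def MStep (h : Sspace n → OdPt N) : Mark n k → Mark n k → Prop :=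
  Step Mark.info (fun p => h p.pos)

theorem MStep.symm {p q : Mark n k} (hs : MStep h p q) : MStep h q p := Step.symm hs

/-- Connectedness by steps. -/
def MConn (h : Sspace n → OdPt N) : Mark n k → Mark n k → Prop := ReflTransGen (MStep h)

theorem MConn.symm {p q : Mark n k} (hs : MConn h p q) : MConn h q p := by
  induction hs with
  | refl => exact .refl
  | tail _ h ih => exact .head h.symm ih

theorem Tight.letter_eq (hn : 3 ≤ n) (ht : Tight n (k + 1) h) {w w' : ℕ} {x y : Sspace n}
    (hl : Link n (k + 1) w w' x y) (hw : w' = 0 ∨ vletter n w' = vletter n w) (z : Mark n k)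
    (hz : Seg (h x) (h z.pos) (h y)) : z.info.letter = vletter n w := by
  rw [z.letter hn]
  rcases ht w w' x y hl z.pos _ (word_lt hn) (z.map_succ hn) hz with h1 | h1
  · rw [h1]
  · rcases hw with hw | hw
    · exact absurd (h1.trans hw) z.word_ne
    · rw [h1, hw]

/-- The marked point of a path of level `k`. -/
noncomputable def IsArc.mark (hn : 3 ≤ n) (ha : IsArc n k e γ) {j : ℕ} (h1 : loIdx n e ≤ j)
    (h2 : j ≤ hiIdx n e) (hw : word n (armOf n e) j ≠ 0) : Mark n k where
  pos := γ (theta n e j)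
  arm := armOf n e
  idx := j
  one_le := (armOf_mem hn ha.one_le ha.le).1
  le := (armOf_mem hn ha.one_le ha.le).2
  idx_le := h2.trans (hi_le hn)
  map_pos := ha.map_theta hn h1 h2
  word_ne := hw

theorem IsArc.step_one (hn : 3 ≤ n) (ht : Tight n (k + 1) h) (ha : IsArc n k e γ) {j : ℕ}
    (h1 : loIdx n e ≤ j) (h2 : j + 1 ≤ hiIdx n e) (hw : word n (armOf n e) j ≠ 0)
    (hw' : word n (armOf n e) (j + 1) ≠ 0) :
    MStep h (ha.mark hn h1 (by omega) hw) (ha.mark hn (by omega) h2 hw') := by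
  obtain ⟨h3, h4⟩ := vinfo_adj hn (h2.trans (hi_le hn)) hw hw'
  have hl := ha.sub_link hn h1 h2
  refine ⟨h3, h (γ (theta n e (j + 1))), fun z hz => ?_, fun z hz => ?_⟩
  · rw [Mark.letter hn (ha.mark hn h1 (by omega) hw)]
    exact ht.letter_eq hn hl (Or.inr h4.symm) z hz
  · rw [Mark.letter hn (ha.mark hn (by omega) h2 hw')]
    exact ht.letter_eq hn hl.symm (Or.inr h4) z ((seg_left _ _).mono hz)

theorem IsArc.step_two (hn : 3 ≤ n) (ht : Tight n (k + 1) h) (ha : IsArc n k e γ) {j : ℕ}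
    (h1 : loIdx n e ≤ j) (h2 : j + 2 ≤ hiIdx n e) (h0 : 0 < j) (hw : word n (armOf n e) j ≠ 0)
    (hw' : word n (armOf n e) (j + 1) = 0) (hw'' : word n (armOf n e) (j + 2) ≠ 0) :
    MStep h (ha.mark hn h1 (by omega) hw) (ha.mark hn (by omega) h2 hw'') := by
  obtain ⟨-, -, h3⟩ := vinfo_adj_two hn (h2.trans (hi_le hn)) h0 hw'
  have hl := ha.sub_link hn h1 (by omega)
  have hl' := ha.sub_link (j := j + 1) hn (by omega) h2
  refine ⟨h3, h (γ (theta n e (j + 1))), fun z hz => ?_, fun z hz => ?_⟩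
  · rw [Mark.letter hn (ha.mark hn h1 (by omega) hw)]
    exact ht.letter_eq hn hl (Or.inl hw') z hz
  · rw [Mark.letter hn (ha.mark hn (by omega) h2 hw'')]
    exact ht.letter_eq hn hl'.symm (Or.inl hw') z hz.symm

theorem IsArc.conn (hn : 3 ≤ n) (ht : Tight n (k + 1) h) (ha : IsArc n k e γ) {i : ℕ}
    (h1 : loIdx n e ≤ i) (h2 : i ≤ hiIdx n e) (hw : word n (armOf n e) i ≠ 0) (j : ℕ)
    (hij : i ≤ j) (h3 : j ≤ hiIdx n e) (hw' : word n (armOf n e) j ≠ 0) :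
    MConn h (ha.mark hn h1 h2 hw) (ha.mark hn (by omega) h3 hw') := by
  induction j using Nat.strong_induction_on with
  | _ j ih =>
    rcases hij.eq_or_lt with rfl | hlt
    · exact .refl
    have hi0 : i ≠ 0 := fun h => hw (by rw [h, word_zero])
    obtain ⟨j, rfl⟩ : ∃ j', j = j' + 1 := ⟨j - 1, by omega⟩
    by_cases h0 : word n (armOf n e) j = 0
    · have hne : i ≠ j := fun h => hw (h ▸ h0)
      obtain ⟨j, rfl⟩ : ∃ j', j = j' + 1 := ⟨j - 1, by omega⟩
      obtain ⟨h5, -, -⟩ := vinfo_adj_two hn (h3.trans (hi_le hn)) (by omega) h0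
      exact (ih j (by omega) (by omega) (by omega) h5).tail
        (ha.step_two hn ht (by omega) h3 (by omega) h5 h0 hw')
    · exact (ih j (by omega) (by omega) (by omega) h0).tail
        (ha.step_one hn ht (by omega) h3 h0 hw')

/-- The marked points attached to a point which is sent to a vertex of `X_0`. -/
def Hub (h : Sspace n → OdPt N) (x : Sspace n) (p : Mark n k) : Prop :=
  ((fS n)^[k] x = vpt n 0 ∧ p.info = .B ∧
    ∀ z : Mark n k, Seg (h p.pos) (h z.pos) (h x) → z.info.letter = p.info.letter) ∨ p.pos = x

theorem Hub.conn (hn : 3 ≤ n) {x : Sspace n} {p q : Mark n k} (hp : Hub h x p)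
    (hq : Hub h x q) : MConn h p q := by
  have hno : ∀ p : Mark n k, (fS n)^[k] x = vpt n 0 → p.pos ≠ x := fun p hx hp => by
    rw [← hp, p.map_pos] at hx
    exact subdivPt_ne_zero hn p.one_le p.le p.idx_le p.idx_ne hx
  rcases hp with ⟨hx, hp, hp'⟩ | hp <;> rcases hq with ⟨hx', hq, hq'⟩ | hq
  · refine .single ⟨?_, h x, hp', fun z hz => hq' z hz.symm⟩
    rw [hp, hq]; trivial
  · exact absurd hq (hno q hx)
  · exact absurd hp (hno p hx')
  · rw [Mark.eq_of_pos hn (hp.trans hq.symm)]; exact .refl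

theorem IsArc.exists_hub (hn : 3 ≤ n) (ht : Tight n (k + 1) h) (ha : IsArc n k e γ) :
    ∃ p : Mark n k, Hub h (γ 0) p ∧ (∃ q, Hub h (γ 1) q ∧ MConn h p q) ∧
      ∀ q : Mark n k, (∃ s ∈ Set.Icc (0 : ℝ) 1, γ s = q.pos) → MConn h p q := by
  obtain ⟨ha1, ha2⟩ := armOf_mem hn ha.one_le ha.le
  have hlt := lo_lt_hi (e := e) hn
  suffices H : ∃ i, ∃ (h1 : loIdx n e ≤ i) (h2 : i ≤ hiIdx n e) (hw : word n (armOf n e) i ≠ 0),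
      Hub h (γ 0) (ha.mark hn h1 h2 hw) ∧
        ∀ j, loIdx n e ≤ j → word n (armOf n e) j ≠ 0 → i ≤ j by
    obtain ⟨i, h1, h2, hw, h3, h4⟩ := H
    have hhi : word n (armOf n e) (hiIdx n e) ≠ 0 := by
      rw [word_hi hn ha.one_le ha.le]
      have := ha.one_le
      unfold phiIdx; grind
    refine ⟨_, h3, ⟨ha.mark hn hlt.le le_rfl hhi, Or.inr ?_, ha.conn hn ht h1 h2 hw _
      (h4 _ hlt.le hhi) le_rfl hhi⟩, ?_⟩
    · simp only [IsArc.mark, theta_hi hn]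
    · rintro q ⟨s, hs, hq⟩
      have hmap := ha.map s hs
      rw [hq, q.map_pos, edgePt] at hmap
      have h5 := edge_length_pos (e := e) hn
      have h6 := tau_mem hn (hi_le (e := e) hn)
      have h7 := tau_mem hn (hlt.le.trans (hi_le (e := e) hn))
      obtain ⟨h8, h9⟩ := pt_inj (by omega) (by have := q.le; have := q.one_le; omega)
        (by omega) (tau_mem hn q.idx_le)
        ⟨by nlinarith [hs.1, h7.1], by nlinarith [hs.2, h6.2]⟩ hmap
      have h10 := tau_lt_of_lt hn (Nat.pos_of_ne_zero q.idx_ne) q.idx_le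
      rw [tau_zero] at h10
      have h11 : q.arm = armOf n e := by
        have := q.one_le
        rcases h9 with h9 | h9 <;> [linarith; omega]
      rw [h11] at h8
      have hlo : loIdx n e ≤ q.idx := by
        by_contra! hc
        have := tau_lt_of_lt hn hc (hlt.le.trans (hi_le hn))
        nlinarith [hs.1]
      have hup : q.idx ≤ hiIdx n e := by
        by_contra! hc
        have := tau_lt_of_lt hn hc (h11 ▸ q.idx_le)
        nlinarith [hs.2]
      have hs' : s = theta n e q.idx := by
        rw [theta, h8, eq_div_iff h5.ne']; ring
      have hqw := q.word_ne
      rw [h11] at hqw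
      have : q = ha.mark hn hlo hup hqw :=
        Mark.eq_of_pos hn (by rw [← hq, hs']; rfl)
      rw [this]
      exact ha.conn hn ht h1 h2 hw _ (h4 _ hlo hqw) hup hqw
  by_cases h0 : word n (armOf n e) (loIdx n e) = 0
  · have hlo : loIdx n e = 0 := by
      unfold loIdx word armOf at *; grind
    have hw1 : word n (armOf n e) 1 = n - 1 := by simp [word]
    have hw1' : word n (armOf n e) 1 ≠ 0 := by omega
    have hx : (fS n)^[k] (γ 0) = vpt n 0 := by
      rw [← theta_lo (n := n) (e := e), ha.map_theta hn le_rfl hlt.le, hlo, subdivPt_zero]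
    refine ⟨1, by omega, by omega, hw1', Or.inl ⟨hx, vinfo_one, fun z hz => ?_⟩, ?_⟩
    · rw [Mark.letter hn (ha.mark hn _ _ hw1')]
      have hl := (ha.sub_link hn le_rfl hlt).symm
      rw [h0, theta_lo, hlo] at hl
      exact ht.letter_eq hn hl (Or.inl rfl) z hz
    · intro j _ hj
      by_contra! hc
      obtain rfl : j = 0 := by omega
      exact hj word_zero
  · refine ⟨_, le_rfl, hlt.le, h0, Or.inr ?_, fun j hj _ => hj⟩
    simp only [IsArc.mark, theta_lo]

/-- Any two marked points are joined by a chain of steps. -/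
theorem mConn_of_tight (hn : 3 ≤ n) (ht : Tight n (k + 1) h) (p q : Mark n k) :
    MConn h p q := by
  obtain ⟨r, hr⟩ : ∃ r : Mark n k, Hub h (vpt n 0) r := by
    obtain ⟨e, γ, ha, hr, -⟩ := exists_isArc hn k (vpt n 0)
    rcases hr.cases_head with heq | ⟨x, ⟨w, w', e', γ', ha', H⟩, -⟩
    · obtain ⟨p, hp, -⟩ := ha.exists_hub hn ht
      exact ⟨p, by rwa [heq]⟩
    · obtain ⟨p, hp, ⟨q, hq, -⟩, -⟩ := ha'.exists_hub hn ht
      rcases H with ⟨-, -, H, -⟩ | ⟨-, -, -, H⟩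
      · exact ⟨p, H ▸ hp⟩
      · exact ⟨q, H ▸ hq⟩
  have hreach : ∀ x, Reach n k x → ∀ p : Mark n k, Hub h x p → MConn h r p := by
    intro x hx
    induction hx with
    | refl => exact fun p hp => hr.conn hn hp
    | tail _ hl ih =>
      obtain ⟨w, w', e, γ, ha, H⟩ := hl
      obtain ⟨p, hp, ⟨q, hq, hpq⟩, -⟩ := ha.exists_hub hn ht
      rcases H with ⟨-, -, rfl, rfl⟩ | ⟨-, -, rfl, rfl⟩
      · exact fun z hz => ((ih p hp).trans hpq).trans (hq.conn hn hz)
      · exact fun z hz => ((ih q hq).trans hpq.symm).trans (hp.conn hn hz)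
  have hall : ∀ p : Mark n k, MConn h r p := fun p => by
    obtain ⟨e, γ, ha, hr, hs⟩ := exists_isArc hn k p.pos
    obtain ⟨p', hp', -, H⟩ := ha.exists_hub hn ht
    exact (hreach _ hr p' hp').trans (H p hs)
  exact (hall p).symm.trans (hall q)

end Connectivity

section Descent
open OdPt
variable {n N k e l : ℕ} {γ : ℝ → Sspace n} {h : Sspace n → OdPt N}

theorem runType_inj (hn : 3 ≤ n) {a b : ℕ} (ha : 1 ≤ a) (han : a ≤ n) (hb : 1 ≤ b) (hbn : b ≤ n)
    (ha' : a ≠ n - 2) (hb' : b ≠ n - 2)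
    (h : (if a = n - 1 then none else some (runType n a : ZMod (n - 2))) =
      if b = n - 1 then none else some (runType n b : ZMod (n - 2))) : a = b := by
  have key : ∀ a, a ≤ n → a ≠ n - 1 → a ≠ n - 2 → runType n a < n - 2 := by
    intro a _ _ _
    unfold runType; split_ifs <;> omega
  split_ifs at h with h1 h2 h2
  · omega
  · rw [Option.some_inj, ZMod.natCast_eq_natCast_iff, Nat.ModEq,
      Nat.mod_eq_of_lt (key a han h1 ha'), Nat.mod_eq_of_lt (key b hbn h2 hb')] at h
    unfold runType at h; split_ifs at h <;> omega

theorem armOf_ne (hn : 3 ≤ n) (h : l ≠ n - 2) : armOf n l ≠ n - 2 := by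
  unfold armOf; split_ifs <;> omega

theorem vletter_word_ne (hn : 3 ≤ n) {j : ℕ} (h : word n (n - 2) j ≠ 0) :
    vletter n (word n (n - 2) j) ≠ some none := by
  unfold word at *
  split_ifs at * <;> first | omega | simp [vletter_b, vletter_b']

theorem phiIdx_le (hn : 3 ≤ n) : phiIdx n l ≤ n + 2 := by
  unfold phiIdx; split_ifs <;> omega

theorem phiIdx_cases (hn : 3 ≤ n) : l = 0 ∧ phiIdx n l = 0 ∨ l = n - 2 ∧ phiIdx n l = n + 1 ∨
    l ≠ 0 ∧ l ≠ n - 2 ∧ (phiIdx n l = n ∧ (l = n - 1 ∨ l = n) ∨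
      phiIdx n l = n + 2 ∧ l ≠ n - 1 ∧ l ≠ n) := by
  unfold phiIdx; grind

/-- Vertices of `X_0` which are sent to the image of the same vertex of an edge. -/
theorem eq_of_phiIdx_eq (hn : 3 ≤ n) (he : 1 ≤ e) (hen : e ≤ n + 2) (hl : l ≤ n + 2) {j : ℕ}
    (h1 : loIdx n e ≤ j) (h2 : j ≤ hiIdx n e) (hw : word n (armOf n e) j = phiIdx n l)
    (ha : l ≠ 0 → l ≠ n - 2 → armOf n e = armOf n l) : l = par n e ∨ l = e := by
  have hj := h2.trans (hi_le hn)
  have hlt := Nat.mod_lt (runType n (armOf n e) + (j - 3) / 2) (show n - 2 > 0 by omega)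
  have hpar : e ≤ n → par n e = 0 := fun h => by unfold par; grind
  have harm : armOf n e = n - 2 → e = n - 2 := fun h => by unfold armOf at h; grind
  rcases (by omega : e ≤ n ∨ e = n + 1 ∨ e = n + 2) with h | rfl | rfl
  · have e1 : armOf n e = e := by unfold armOf; grind
    rcases phiIdx_cases (l := l) hn with ⟨h3, -⟩ | ⟨h3, h4⟩ | ⟨h3, h4, h5⟩
    · rw [h3, hpar h]; exact Or.inl rfl
    · right
      rw [h4] at hw
      unfold word at hw
      grind
    · right
      have h6 := ha h3 h4
      rw [e1] at h6 hw
      rcases (by omega : l ≤ n ∨ l = n + 1 ∨ l = n + 2) with h7 | rfl | rfl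
      · unfold armOf at h6; grind
      · have h8 : e = n - 1 := by unfold armOf at h6; grind
        have e2 : hiIdx n e = 3 := by unfold hiIdx; grind
        unfold word at hw
        grind
      · have h8 : e = n := by unfold armOf at h6; grind
        have e2 : hiIdx n e = 2 * n - 1 := by unfold hiIdx; grind
        have h9 : phiIdx n (n + 2) = n + 2 := by unfold phiIdx; grind
        rw [h8] at hw hlt
        rw [armOf] at hlt
        unfold word at hw
        rw [h9] at hw
        split_ifs at hw hlt <;> omega
  · have e1 : armOf n (n + 1) = n - 1 := by unfold armOf; grind
    have e2 : loIdx n (n + 1) = 3 := by unfold loIdx; grind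
    have e3 : par n (n + 1) = n - 1 := by unfold par; grind
    rw [e1, word] at hw
    rw [e1] at ha
    rw [e2] at h1
    rw [e3]
    rcases phiIdx_cases (l := l) hn with ⟨h3, h4⟩ | ⟨h3, h4⟩ | ⟨h3, h4, -⟩
    · rw [h4] at hw; split_ifs at hw <;> omega
    · rw [h4] at hw; split_ifs at hw <;> omega
    · have := ha h3 h4
      unfold armOf at this; split_ifs at this <;> omega
  · have e1 : armOf n (n + 2) = n := by unfold armOf; grind
    have e2 : loIdx n (n + 2) = 2 * n - 1 := by unfold loIdx; grind
    have e3 : par n (n + 2) = n := by unfold par; grind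
    rw [e1, word] at hw
    rw [e1] at ha
    rw [e2] at h1
    rw [e3]
    rcases phiIdx_cases (l := l) hn with ⟨h3, h4⟩ | ⟨h3, h4⟩ | ⟨h3, h4, -⟩
    · rw [h4] at hw; split_ifs at hw <;> omega
    · rw [h4] at hw; split_ifs at hw <;> omega
    · have := ha h3 h4
      unfold armOf at this; split_ifs at this <;> omega

theorem IsArc.exists_seg (hn : 3 ≤ n) {z : Sspace n} (hz : Seg (h (γ 0)) (h z) (h (γ 1))) :
    ∃ j, loIdx n e ≤ j ∧ j < hiIdx n e ∧
      Seg (h (γ (theta n e j))) (h z) (h (γ (theta n e (j + 1)))) := by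
  have hlt := lo_lt_hi (e := e) hn
  suffices H : ∀ i, loIdx n e + 1 ≤ i → i ≤ hiIdx n e →
      Seg (h (γ 0)) (h z) (h (γ (theta n e i))) → ∃ j, loIdx n e ≤ j ∧ j < hiIdx n e ∧
        Seg (h (γ (theta n e j))) (h z) (h (γ (theta n e (j + 1)))) by
    exact H _ hlt le_rfl (by rwa [theta_hi hn])
  intro i hi
  induction i, hi using Nat.le_induction with
  | base => exact fun hi hs => ⟨loIdx n e, le_rfl, hi, by rwa [theta_lo]⟩
  | succ i hi ih =>
    intro hi' hs
    rcases hs.split (h (γ (theta n e i))) with hs | hs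
    · exact ih (by omega) hs
    · exact ⟨i, by omega, hi', hs⟩

theorem Tight.of_succ (hn : 3 ≤ n) {h : Sspace n → OdPt (n - 1)} (ht : Tight n (k + 1) h) :
    Tight n k h := by
  suffices H : ∀ e γ, IsArc n k e γ → ∀ z, ∀ l ≤ n + 2, (fS n)^[k] z = vpt n l →
      Seg (h (γ 0)) (h z) (h (γ 1)) → l = par n e ∨ l = e by
    rintro w w' x y ⟨e, γ, ha, ⟨rfl, rfl, rfl, rfl⟩ | ⟨rfl, rfl, rfl, rfl⟩⟩ z l hl hz hs
    · exact H _ γ ha z l hl hz hs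
    · exact (H _ γ ha z l hl hz hs.symm).symm
  intro e γ ha z l hl hz hs
  obtain ⟨j, h1, h2, hs⟩ := IsArc.exists_seg (e := e) hn hs
  have hlink := ha.sub_link hn h1 h2
  obtain ⟨ha1, ha2⟩ := armOf_mem hn ha.one_le ha.le
  have hz' : (fS n)^[k + 1] z = vpt n (phiIdx n l) := by
    rw [Function.iterate_succ_apply', hz, fS_vpt hn hl]
  have hadj : word n (armOf n e) j ≠ 0 → word n (armOf n e) (j + 1) ≠ 0 →
      vletter n (word n (armOf n e) j) = vletter n (word n (armOf n e) (j + 1)) :=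
    fun hw hw' => (vinfo_adj hn (h2.trans_le (hi_le hn)) hw hw').2
  obtain ⟨i, hi1, hi2, hw, w', y, hl', hs', hor⟩ : ∃ i, loIdx n e ≤ i ∧ i ≤ hiIdx n e ∧
      word n (armOf n e) i = phiIdx n l ∧ ∃ w' y,
        Link n (k + 1) (word n (armOf n e) i) w' (γ (theta n e i)) y ∧
        Seg (h (γ (theta n e i))) (h z) (h y) ∧ (word n (armOf n e) i ≠ 0 →
          w' = 0 ∨ vletter n w' = vletter n (word n (armOf n e) i)) := by
    rcases ht _ _ _ _ hlink z _ (phiIdx_le hn) hz' hs with hw | hw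
    · refine ⟨j, h1, h2.le, hw.symm, _, _, hlink, hs, fun h0 => ?_⟩
      rw [or_iff_not_imp_left]; exact fun h0' => (hadj h0 h0').symm
    · refine ⟨j + 1, by omega, h2, hw.symm, _, _, hlink.symm, hs.symm, fun h0 => ?_⟩
      rw [or_iff_not_imp_left]; exact fun h0' => hadj h0' h0
  refine eq_of_phiIdx_eq hn ha.one_le ha.le hl hi1 hi2 hw fun hl0 hl2 => ?_
  obtain ⟨hb1, hb2⟩ := armOf_mem hn (by omega : 1 ≤ l) hl
  have hC : vletter n (phiIdx n l) = some none := by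
    rcases phiIdx_cases (l := l) hn with ⟨h3, -⟩ | ⟨h3, -⟩ | ⟨-, -, ⟨h3, -⟩ | ⟨h3, -⟩⟩
    · contradiction
    · contradiction
    · rw [h3, vletter_c hn]
    · rw [h3, vletter_c' hn]
  have hphi : phiIdx n l ≠ 0 := by
    rcases phiIdx_cases (l := l) hn with ⟨h3, -⟩ | ⟨h3, -⟩ | ⟨-, -, ⟨h3, -⟩ | ⟨h3, -⟩⟩ <;> omega
  have hw0 : word n (armOf n e) i ≠ 0 := by rwa [hw]
  have hhi : word n (armOf n l) (hiIdx n l) ≠ 0 := by rwa [word_hi hn (by omega) hl]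
  let p : Mark n k := ha.mark hn hi1 hi2 hw0
  let q : Mark n k := ⟨z, armOf n l, hiIdx n l, hb1, hb2, hi_le hn,
    by rw [hz, vpt_eq hn (by omega) hl], hhi⟩
  have hpl : p.info.letter = some none := by
    rw [p.letter hn, ← hC, ← hw]; rfl
  have hql : q.info.letter = some none := by
    rw [q.letter hn, ← hC, ← word_hi hn (by omega) hl]
  have hvis : CVisible Mark.info (fun p : Mark n k => h p.pos) q p := by
    refine ⟨hpl, fun u hu => ?_⟩
    rw [ht.letter_eq hn hl' (hor hw0) u (hs'.mono hu), hw, hC]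
  have : NeZero (n - 2) := ⟨by omega⟩
  have htyp := typ_eq_of_cVisible (info := Mark.info) (h := fun p : Mark n k => h p.pos)
    (by omega : n - 1 < n - 2 + 2) (fun z t l => vinfo_wf hn) hql hvis (mConn_of_tight hn ht q p)
  have t1 : p.info.typ =
      if armOf n e = n - 1 then none else some (runType n (armOf n e) : ZMod (n - 2)) :=
    typ_of_c hn p.idx_le (by rw [← p.letter hn, hpl]) hw0
  have t2 : q.info.typ =
      if armOf n l = n - 1 then none else some (runType n (armOf n l) : ZMod (n - 2)) :=
    typ_of_c hn q.idx_le (by rw [← q.letter hn, hql]) hhi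
  rw [t1, t2] at htyp
  refine (runType_inj hn hb1 hb2 ha1 ha2 (armOf_ne hn hl2) (fun h5 => ?_) htyp).symm
  rw [← hw, h5] at hC
  exact vletter_word_ne hn (by rwa [← h5]) hC

end Descent

section Base
open OdPt
variable {n N : ℕ} {h : Sspace n → OdPt N}

theorem link_vpt (hn : 3 ≤ n) {e : ℕ} (he : 1 ≤ e) (hen : e ≤ n + 2) :
    Link n 0 (par n e) e (vpt n (par n e)) (vpt n e) :=
  ⟨e, _, isArc_edgePt he hen, Or.inl ⟨rfl, rfl, edgePt_zero hn hen, edgePt_one hn he hen⟩⟩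

/-- The index of the tip of the ray `i` of the graph `X_0`. -/
def tipIdx (n i : ℕ) : ℕ := if i = n - 2 then n + 1 else if i = n - 1 then n + 2 else i + 1

theorem Tight.not_seg_tip (hn : 3 ≤ n) (ht : Tight n 0 h) {i j : ℕ} (hi : i < n) (hj : j < n)
    (hij : i ≠ j) : ¬ Seg (h (vpt n 0)) (h (vpt n (tipIdx n i))) (h (vpt n (tipIdx n j))) := by
  intro hs
  have hl : tipIdx n i ≤ n + 2 := by unfold tipIdx; split_ifs <;> omega
  have H : ∀ e, 1 ≤ e → e ≤ n + 2 →
      Seg (h (vpt n (par n e))) (h (vpt n (tipIdx n i))) (h (vpt n e)) →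
      tipIdx n i = par n e ∨ tipIdx n i = e :=
    fun e he hen => ht _ _ _ _ (link_vpt hn he hen) _ _ hl rfl
  rcases (by omega : j < n - 2 ∨ j = n - 2 ∨ j = n - 1) with h1 | h1 | h1
  · have e1 : tipIdx n j = j + 1 := by unfold tipIdx; split_ifs <;> omega
    have e2 : par n (j + 1) = 0 := by unfold par; split_ifs <;> omega
    have := H (j + 1) (by omega) (by omega) (by rwa [e2, ← e1])
    unfold tipIdx at this; split_ifs at this <;> omega
  · have e1 : tipIdx n j = n + 1 := by unfold tipIdx; split_ifs; rfl
    have e2 : par n (n + 1) = n - 1 := by unfold par; split_ifs <;> omega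
    have e3 : par n (n - 1) = 0 := by unfold par; split_ifs <;> omega
    rw [e1] at hs
    rcases hs.split (h (vpt n (n - 1))) with hs | hs
    · have := H (n - 1) (by omega) (by omega) (by rwa [e3])
      unfold tipIdx at this; split_ifs at this <;> omega
    · have := H (n + 1) (by omega) (by omega) (by rwa [e2])
      unfold tipIdx at this; split_ifs at this <;> omega
  · have e1 : tipIdx n j = n + 2 := by unfold tipIdx; split_ifs <;> omega
    have e2 : par n (n + 2) = n := by unfold par; split_ifs <;> omega
    have e3 : par n n = 0 := by unfold par; split_ifs <;> omega
    rw [e1] at hs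
    rcases hs.split (h (vpt n n)) with hs | hs
    · have := H n (by omega) (by omega) (by rwa [e3])
      unfold tipIdx at this; split_ifs at this <;> omega
    · have := H (n + 2) (by omega) (by omega) (by rwa [e2])
      unfold tipIdx at this; split_ifs at this <;> omega

theorem not_tight_zero (hn : 3 ≤ n) (h : Sspace n → OdPt (n - 1)) : ¬ Tight n 0 h := by
  intro ht
  obtain ⟨i, j, hij, harm⟩ := Fintype.exists_ne_map_eq_of_card_lt
    (fun i : Fin n => (h (vpt n (tipIdx n i))).arm) (by simp; omega)
  obtain ⟨m, hmi, hmj⟩ : ∃ m : Fin n, m ≠ i ∧ m ≠ j := by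
    have : ∃ m, m ∉ ({i, j} : Finset (Fin n)) := by
      by_contra! hc
      have := Finset.card_le_card (fun x _ => hc x : (Finset.univ : Finset (Fin n)) ⊆ {i, j})
      have := Finset.card_le_two (a := i) (b := j)
      simp at *; omega
    simpa using this
  have H : ∀ a b : Fin n, a ≠ b → ¬ Seg (h (vpt n 0)) (h (vpt n (tipIdx n a)))
      (h (vpt n (tipIdx n b))) :=
    fun a b hab => ht.not_seg_tip hn a.2 b.2 fun h => hab (Fin.ext h)
  have h1 := H i j hij
  have h2 := H j i hij.symm
  have h3 := H i m hmi.symm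
  have h4 := H m i hmi
  have h5 := H j m hmj.symm
  have h6 := H m j hmj
  generalize h (vpt n (tipIdx n i)) = a at *
  generalize h (vpt n (tipIdx n j)) = b at *
  generalize h (vpt n (tipIdx n m)) = c at *
  have := a.nonneg
  have := b.nonneg
  have := c.nonneg
  clear H
  unfold Seg at *; unfold Below at *
  grind

end Base

namespace OdPt
variable {m : ℕ}

/-- The coordinate of a point of a simple `m`-od in the cone over `m` points. -/
def coord (p : OdPt m) (e : Fin m) : ℝ := if p.arm = e then p.dep else 0

theorem sum_coord (p : OdPt m) : ∑ e, p.coord e = p.dep := by simp [coord]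

theorem coord_eq_iff {p q : OdPt m} :
    p.coord = q.coord ↔ p.dep = q.dep ∧ (p.dep = 0 ∨ p.arm = q.arm) := by
  constructor
  · intro h
    have h1 : p.dep = q.dep := by rw [← sum_coord p, ← sum_coord q, h]
    refine ⟨h1, ?_⟩
    have h2 := congrFun h p.arm
    unfold coord at h2
    grind
  · rintro ⟨h1, h2⟩
    funext e
    unfold coord
    grind

theorem exists_coord_retract [NeZero m] (u : Fin m → ℝ) :
    ∃ p : OdPt m, ∀ e, max 0 (u e + |u e| - ∑ e', |u e'|) = p.coord e := by
  by_cases h : ∃ a, 0 < u a + |u a| - ∑ e', |u e'|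
  · obtain ⟨a, ha⟩ := h
    refine ⟨⟨a, _, ha.le⟩, fun e => ?_⟩
    unfold coord
    by_cases hae : a = e
    · subst hae; rw [if_pos rfl]; exact max_eq_right ha.le
    · rw [if_neg hae]
      refine max_eq_left ?_
      have h1 : |u a| + |u e| ≤ ∑ e', |u e'| := by
        rw [← Finset.sum_pair (f := fun e => |u e|) hae]
        exact Finset.sum_le_sum_of_subset_of_nonneg (Finset.subset_univ _)
          fun _ _ _ => abs_nonneg _
      have h2 := le_abs_self (u a)
      have h3 := le_abs_self (u e)
      linarith
  · push Not at h
    exact ⟨⟨0, 0, le_rfl⟩, fun e => by simp [coord, h e]⟩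

theorem retract_coord (p : OdPt m) (e : Fin m) :
    max 0 (p.coord e + |p.coord e| - ∑ e', |p.coord e'|) = p.coord e := by
  have h : ∀ e, |p.coord e| = p.coord e := fun e => by
    refine abs_of_nonneg ?_
    unfold coord; split_ifs; exacts [p.nonneg, le_rfl]
  simp only [h, sum_coord]
  have := p.nonneg
  unfold coord
  split_ifs
  · rw [add_sub_cancel_right, max_eq_right this]
  · simpa using this

theorem Seg.exists_coord_eq {γ : ℝ → OdPt m} {w : OdPt m}
    (hγ : ∀ e, ContinuousOn (fun s => (γ s).coord e) (Set.Icc 0 1))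
    (h : Seg (γ 0) w (γ 1)) : ∃ s ∈ Set.Icc (0 : ℝ) 1, (γ s).coord = w.coord := by
  have hF : ∀ a (p : OdPt m), 2 * p.coord a - ∑ e, p.coord e =
      if p.arm = a then p.dep else -p.dep := by
    intro a p
    rw [sum_coord]; unfold coord; split_ifs <;> ring
  obtain ⟨a, ha, hb⟩ : ∃ a, (w.dep = 0 ∨ w.arm = a) ∧
      w.dep ∈ Set.uIcc (2 * (γ 0).coord a - ∑ e, (γ 0).coord e)
        (2 * (γ 1).coord a - ∑ e, (γ 1).coord e) := by
    have h0 := w.nonneg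
    have h1 := (γ 0).nonneg
    have h2 := (γ 1).nonneg
    simp only [hF, Set.mem_uIcc]
    unfold Seg Below at h
    by_cases hw : w.dep = 0
    · exact ⟨(γ 0).arm, Or.inl hw, by grind⟩
    · exact ⟨w.arm, Or.inr rfl, by grind⟩
  have hcont : ContinuousOn (fun s => 2 * (γ s).coord a - ∑ e, (γ s).coord e)
      (Set.uIcc 0 1) := by
    rw [Set.uIcc_of_le zero_le_one]
    exact (continuousOn_const.mul (hγ a)).sub (continuousOn_finsetSum _ fun e _ => hγ e)
  obtain ⟨s, hs, hs'⟩ := intermediate_value_uIcc hcont hb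
  rw [Set.uIcc_of_le zero_le_one] at hs
  refine ⟨s, hs, coord_eq_iff.2 ?_⟩
  simp only [hF] at hs'
  have h0 := w.nonneg
  have h1 := (γ s).nonneg
  grind

/-- Continuous coordinates on the plane, restricting to the arm coordinates on the simple
`m`-od. -/
theorem exists_continuous_coord (hm : m ≠ 0) : ∃ d : ℂ → Fin m → ℝ, Continuous d ∧
    ∀ z ∈ simpleOdSet m, ∃ p : OdPt m, d z = p.coord ∧ z = embC m (p.arm, p.dep) := by
  obtain ⟨ω, hω⟩ : ∃ ω : Fin m → ℂ, ∀ k, ω k =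
    Complex.exp (2 * Real.pi * Complex.I * (k : ℕ) / m) := ⟨_, fun _ => rfl⟩
  have hone : ∀ k, ‖ω k‖ = 1 := fun k => by rw [hω, norm_exp_arm]
  have hne : ∀ k l, k ≠ l → 0 < ‖ω k - ω l‖ := by
    intro k l hkl
    rw [norm_pos_iff, sub_ne_zero]
    intro h
    have h1 := embC_inj (n := m) hm k.2 l.2 (t := 1) (t' := 1) (by simp) (by simp)
      (by simpa [embC, hω] using h)
    rcases h1.2 with h2 | h2
    · exact one_ne_zero h2
    · exact hkl (Fin.ext h2)
  obtain ⟨C, hC⟩ : ∃ C : ℝ, ∀ k l, k ≠ l → 1 ≤ C * ‖ω k - ω l‖ := by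
    refine ⟨∑ p : Fin m × Fin m, ‖ω p.1 - ω p.2‖⁻¹, fun k l hkl => ?_⟩
    rw [← inv_mul_cancel₀ (hne k l hkl).ne']
    refine mul_le_mul_of_nonneg_right ?_ (hne k l hkl).le
    exact Finset.single_le_sum (f := fun p : Fin m × Fin m => ‖ω p.1 - ω p.2‖⁻¹)
      (fun _ _ => inv_nonneg.2 (norm_nonneg _)) (Finset.mem_univ (k, l))
  refine ⟨fun z e => max 0 (‖z‖ - C * ‖z - ‖z‖ * ω e‖), by fun_prop, ?_⟩
  rintro z ⟨t, k, ht, hk, rfl⟩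
  refine ⟨⟨⟨k, hk⟩, t, ht.1⟩, ?_, ?_⟩
  · funext e
    have h1 : (t : ℂ) * Complex.exp (2 * Real.pi * Complex.I * (k : ℂ) / (m : ℂ)) =
        t * ω ⟨k, hk⟩ := by rw [hω]
    have h2 : ‖(t : ℂ) * ω ⟨k, hk⟩‖ = t := by
      rw [norm_mul, hone, mul_one, Complex.norm_real, Real.norm_of_nonneg ht.1]
    simp only [h1, h2, ← mul_sub, norm_mul, Complex.norm_real, Real.norm_of_nonneg ht.1]
    unfold coord
    split_ifs with h3
    · simp [← h3, ht.1]
    · refine max_eq_left ?_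
      have h4 := mul_le_mul_of_nonneg_left (hC _ _ h3) ht.1
      nlinarith
  · simp [embC, max_eq_right ht.1, min_eq_right ht.2]

end OdPt

section Reduction
open OdPt
variable {n k e l N : ℕ}

theorem eq_of_edgePt_eq_vpt (hn : 3 ≤ n) (he : 1 ≤ e) (hen : e ≤ n + 2) (hl : l ≤ n + 2) {s : ℝ}
    (hs : s ∈ Set.Icc (0 : ℝ) 1) (h : edgePt n e s = vpt n l) : l = par n e ∨ l = e := by
  have hd := edge_length_pos (e := e) hn
  have hlo := lo_lt_hi (e := e) hn
  obtain ⟨ha, han⟩ := armOf_mem hn he hen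
  have h1 := tau_mem hn (hi_le (e := e) hn)
  have h2 := tau_mem hn (hlo.le.trans (hi_le (e := e) hn))
  have hp1 : tau n (armOf n e) (loIdx n e) ≤ tau n (armOf n e) (loIdx n e) +
      s * (tau n (armOf n e) (hiIdx n e) - tau n (armOf n e) (loIdx n e)) :=
    le_add_of_nonneg_right (mul_nonneg hs.1 hd.le)
  have hp2 : tau n (armOf n e) (loIdx n e) +
      s * (tau n (armOf n e) (hiIdx n e) - tau n (armOf n e) (loIdx n e)) ≤
      tau n (armOf n e) (hiIdx n e) := by
    nlinarith [mul_le_mul_of_nonneg_right hs.2 hd.le]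
  have hp : tau n (armOf n e) (loIdx n e) +
      s * (tau n (armOf n e) (hiIdx n e) - tau n (armOf n e) (loIdx n e)) ∈ Set.Icc (0 : ℝ) 1 :=
    ⟨h2.1.trans hp1, hp2.trans h1.2⟩
  rcases Nat.eq_zero_or_pos l with rfl | hl0
  · left
    rw [← pt_zero 0, edgePt] at h
    have h3 := (pt_inj (by omega) (by omega) (by omega) hp (by simp) h).1
    have h4 : loIdx n e = 0 := by
      by_contra h0
      have := tau_lt_of_lt hn (Nat.pos_of_ne_zero h0) (hlo.le.trans (hi_le (e := e) hn))
      rw [tau_zero] at this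
      linarith
    unfold loIdx at h4
    unfold par
    grind
  · obtain ⟨hb, hbn⟩ := armOf_mem hn hl0 hl
    rw [vpt_eq hn hl0 hl, edgePt, subdivPt] at h
    obtain ⟨h3, h4⟩ := pt_inj (by omega) (by omega) (by omega) hp (tau_mem hn (hi_le hn)) h
    have h5 : armOf n l = armOf n e := by
      rcases h4 with h4 | h4
      · have := lo_lt_hi (e := l) hn
        have := tau_lt_of_lt hn (by omega : 0 < hiIdx n l) (hi_le hn)
        rw [tau_zero] at this
        linarith
      · omega
    rw [h5] at h3
    have h6 : hiIdx n l ≤ hiIdx n e := by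
      by_contra! h0
      have := tau_lt_of_lt hn h0 (h5 ▸ hi_le (e := l) hn)
      linarith
    have h7 : loIdx n e ≤ hiIdx n l := by
      by_contra! h0
      have := tau_lt_of_lt hn h0 (hlo.le.trans (hi_le hn))
      linarith
    unfold armOf at h5
    unfold hiIdx armLen armOf at h6
    unfold par
    grind

/-- The pairs of points whose first member lies on an edge of `X_0` and whose second member is a
vertex off this edge. -/
def farPairs (n : ℕ) : Set (Sspace n × Sspace n) :=
  ⋃ q ∈ {q : ℕ × ℕ | (1 ≤ q.1 ∧ q.1 ≤ n + 2) ∧ q.2 ≤ n + 2 ∧ q.2 ≠ par n q.1 ∧ q.2 ≠ q.1},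
    (edgePt n q.1 '' Set.Icc 0 1) ×ˢ {vpt n q.2}

theorem isCompact_farPairs : IsCompact (farPairs n) := by
  refine Set.Finite.isCompact_biUnion ?_ fun q _ =>
    (isCompact_Icc.image (continuous_edgePt q.1)).prod isCompact_singleton
  exact ((Set.finite_Iic (n + 2)).prod (Set.finite_Iic (n + 2))).subset
    fun q hq => ⟨hq.1.2, hq.2.1⟩

theorem exists_lt_dist_farPairs (hn : 3 ≤ n) :
    ∃ δ > 0, ∀ p ∈ farPairs n, δ ≤ dist p.1 p.2 := by
  refine isCompact_farPairs.exists_forall_le' continuous_dist.continuousOn fun p hp => ?_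
  simp only [farPairs, Set.mem_iUnion] at hp
  obtain ⟨q, hq, ⟨s, hs, h1⟩, h2⟩ := hp
  rw [dist_pos]
  intro h
  rw [← h1, Set.mem_singleton_iff.1 h2] at h
  rcases eq_of_edgePt_eq_vpt hn hq.1.1 hq.1.2 hq.2.1 hs h with h | h
  · exact hq.2.2.1 h
  · exact hq.2.2.2 h

theorem tight_of_coord {m : ℕ} {h : Sspace n → OdPt m}
    (hc : ∀ e, Continuous fun x => (h x).coord e)
    (hf : ∀ x y, (h x).coord = (h y).coord → ((fS n)^[k] x, (fS n)^[k] y) ∉ farPairs n) :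
    Tight n k h := by
  have H : ∀ e γ, IsArc n k e γ → ∀ z, ∀ l ≤ n + 2, (fS n)^[k] z = vpt n l →
      Seg (h (γ 0)) (h z) (h (γ 1)) → l = par n e ∨ l = e := by
    intro e γ ha z l hl hz hs
    obtain ⟨s, hs, hs'⟩ := Seg.exists_coord_eq (γ := fun s => h (γ s))
      (fun e => (hc e).comp_continuousOn ha.cont) hs
    by_contra! hne
    refine hf _ _ hs' ?_
    rw [ha.map s hs, hz]
    simp only [farPairs, Set.mem_iUnion]
    exact ⟨(e, l), ⟨⟨ha.one_le, ha.le⟩, hl, hne⟩, ⟨s, hs, rfl⟩, rfl⟩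
  rintro w w' x y ⟨e, γ, ha, ⟨rfl, rfl, rfl, rfl⟩ | ⟨rfl, rfl, rfl, rfl⟩⟩ z l hl hz hs
  · exact H _ γ ha z l hl hz hs
  · exact (H _ γ ha z l hl hz hs.symm).symm

/-- The point of the product whose first coordinates are the images of `x` under the iterates of
the bonding map, ending with `x` at the place `N`. -/
noncomputable def approx (n N : ℕ) (x : Sspace n) (k : ℕ) : Sspace n := (fS n)^[N - k] x

theorem continuous_approx (hn : 3 ≤ n) (N : ℕ) : Continuous (approx n N) :=
  continuous_pi fun _ => (continuous_fS hn).iterate _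

theorem fS_approx (h : k < N) (x : Sspace n) :
    fS n (approx n N x (k + 1)) = approx n N x k := by
  unfold approx
  rw [← Function.iterate_succ_apply' (fS n)]
  congr 2; omega

/-- A closed relation which holds between approximations of all orders holds between points of the
inverse limit. -/
theorem exists_mem_nK_of_approx (hn : 3 ≤ n)
    {R : Set ((ℕ → Sspace n) × (ℕ → Sspace n))} (hR : IsClosed R)
    (h : ∀ N, ∃ x y, (approx n N x, approx n N y) ∈ R) :
    ∃ X Y : nK n, (X.1, Y.1) ∈ R := by
  choose x y hxy using h
  obtain ⟨⟨X, Y⟩, ψ, hψ, hlim⟩ := SeqCompactSpace.tendsto_subseq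
    fun N => (approx n N (x N), approx n N (y N))
  have key : ∀ {u : ℕ → Sspace n} {U : ℕ → Sspace n},
      Filter.Tendsto (fun i => approx n (ψ i) (u (ψ i))) Filter.atTop (nhds U) →
      ∀ k, fS n (U (k + 1)) = U k := by
    intro u U hu k
    rw [tendsto_pi_nhds] at hu
    refine tendsto_nhds_unique_of_eventuallyEq
      (((continuous_fS hn).tendsto _).comp (hu (k + 1))) (hu k) ?_
    filter_upwards [Filter.eventually_gt_atTop k] with i hi
    exact fS_approx (hi.trans_le hψ.le_apply) _
  rw [Prod.tendsto_iff] at hlim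
  exact ⟨⟨X, key hlim.1⟩, ⟨Y, key hlim.2⟩,
    hR.mem_of_tendsto (hlim.1.prodMk_nhds hlim.2) (Filter.Eventually.of_forall fun i => hxy _)⟩

end Reduction

section Main
open OdPt
variable {n N : ℕ}

theorem isClosed_nK (hn : 3 ≤ n) :
    IsClosed {x : ℕ → Sspace n | ∀ k, fS n (x (k + 1)) = x k} := by
  simp only [Set.ofPred_forall]
  exact isClosed_iInter fun k =>
    isClosed_eq ((continuous_fS hn).comp (continuous_apply _)) (continuous_apply _)

theorem dist_zero_lt_of_diam_lt (hn : 3 ≤ n) {δ : ℝ} {A : Set (nK n)}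
    (hA : Metric.diam A < min 1 δ) {X Y : nK n} (hX : X ∈ A) (hY : Y ∈ A) :
    dist (X.1 0) (Y.1 0) < δ := by
  have hc : CompactSpace (nK n) := isCompact_iff_compactSpace.1 (isClosed_nK hn).isCompact
  have h1 : dist X Y ≤ Metric.diam A :=
    Metric.dist_le_diam_of_mem (isCompact_univ.isBounded.subset (Set.subset_univ _)) hX hY
  have h2 : min (2⁻¹ ^ Encodable.encode 0) (dist (X.1 0) (Y.1 0)) ≤ dist X Y :=
    PiCountable.min_dist_le_dist_pi X.1 Y.1 0
  rw [show Encodable.encode 0 = 0 from rfl, pow_zero] at h2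
  grind

theorem exists_tight (hn : 3 ≤ n) (H : IsLike (nK n) (simpleOdSet (n - 1))) :
    ∃ N, ∃ h : Sspace n → OdPt (n - 1), Tight n N h := by
  have : NeZero (n - 1) := ⟨by omega⟩
  obtain ⟨δ, hδ, hfar⟩ := exists_lt_dist_farPairs hn
  obtain ⟨g, hg, -, hdiam⟩ := H (min 1 δ) (by positivity)
  obtain ⟨d, hd, hd'⟩ := exists_continuous_coord (m := n - 1) (NeZero.ne _)
  obtain ⟨U, hU⟩ := ContinuousMap.exists_extension' (isClosed_nK hn).isClosedEmbedding_subtypeVal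
    ⟨fun x => d (g x), hd.comp (continuous_subtype_val.comp hg)⟩
  have hUx : ∀ X : nK n, U X.1 = d (g X) := fun X => congrFun hU X
  choose P hP using fun t => exists_coord_retract (U t)
  have hPc : ∀ e, Continuous fun t => (P t).coord e := by
    intro e
    simp only [← hP]
    fun_prop
  have hPx : ∀ X : nK n, (P X.1).coord = d (g X) := by
    intro X
    obtain ⟨p, hp, -⟩ := hd' _ (g X).2
    funext e
    rw [← hP, hUx, hp, retract_coord]
  by_contra! hcon
  obtain ⟨X, Y, hXY, hXY'⟩ := exists_mem_nK_of_approx hn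
    (R := {p | (P p.1).coord = (P p.2).coord ∧ (p.1 0, p.2 0) ∈ farPairs n}) (by
      refine IsClosed.inter (isClosed_eq ?_ ?_) (isCompact_farPairs.isClosed.preimage ?_)
      · exact continuous_pi fun e => (hPc e).comp continuous_fst
      · exact continuous_pi fun e => (hPc e).comp continuous_snd
      · fun_prop) (by
      intro N
      by_contra! hN
      exact hcon N (fun x => P (approx n N x)) (tight_of_coord
        (fun e => (hPc e).comp (continuous_approx hn N)) fun x y h1 h2 => hN x y ⟨h1, h2⟩))
  refine (hfar _ hXY').not_gt (dist_zero_lt_of_diam_lt hn (hdiam (g X)) rfl ?_)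
  rw [hPx, hPx] at hXY
  obtain ⟨p, hp, hp'⟩ := hd' _ (g X).2
  obtain ⟨q, hq, hq'⟩ := hd' _ (g Y).2
  rw [hp, hq, coord_eq_iff] at hXY
  refine Subtype.ext ?_
  rw [hp', hq', ← hXY.1]
  rcases hXY.2 with h | h
  · rw [h, embC_zero, embC_zero]
  · rw [h]

end Main

/-- For `n ≥ 3`, the inverse limit `nK` of the bonding map `φ = nφ`
is not simple-`(n-1)`-od-like. -/
theorem statement11 (n : ℕ) (hn : 3 ≤ n) :
    ¬ IsLike (nK n) (simpleOdSet (n - 1)) := by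
  intro H
  obtain ⟨N, h, ht⟩ := exists_tight hn H
  induction N with
  | zero => exact not_tight_zero hn h ht
  | succ N ih => exact ih (ht.of_succ hn)
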